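/- The prime 19 is 57-regular; that is, 19 does not divide the class number of the number field ℚ(√57, ζ₁₉) obtained by adjoining a primitive 19-th root of unity ζ₁₉ to ℚ(√57). (Equivalently, since ℚ(√57, ζ₁₉) = ℚ(√−3, ζ₁₉) = ℚ(ζ₅₇), the prime 19 does not divide the class number of the cyclotomic field ℚ(ζ₅₇).) -/

import Mathlib

section IdealEulerProduct

open IsDedekindDomain NumberField Filter Topology

variable {R : Type*} [CommRing R] [IsDedekindDomain R]

/-- The nonzero ideals all of whose prime factors lie in a given finite set. -/
def factoredIdeals (S : Finset (HeightOneSpectrum R)) : Set (Ideal R) :=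
  {I | I ≠ ⊥ ∧ ∀ P : HeightOneSpectrum R, P.asIdeal ∣ I → P ∈ S}

theorem factoredIdeals_empty : factoredIdeals (∅ : Finset (HeightOneSpectrum R)) = {1} := by
  ext I
  simp only [factoredIdeals, Finset.notMem_empty, imp_false, Set.mem_ofPred_eq,
    Set.mem_singleton_iff, Ideal.one_eq_top]
  constructor
  · rintro ⟨h0, h⟩
    by_contra hI
    obtain ⟨M, hM, hIM⟩ := Ideal.exists_le_maximal I hI
    have hM0 : M ≠ ⊥ := fun h ↦ h0 (le_bot_iff.mp (h ▸ hIM))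
    exact h ⟨M, hM.isPrime, hM0⟩ (Ideal.dvd_iff_le.mpr hIM)
  · rintro rfl
    exact ⟨top_ne_bot, fun P hP ↦ P.isPrime.ne_top (top_le_iff.mp (Ideal.dvd_iff_le.mp hP))⟩

theorem bijOn_factoredIdeals_insert [DecidableEq (HeightOneSpectrum R)]
    (S : Finset (HeightOneSpectrum R)) {P : HeightOneSpectrum R} (hP : P ∉ S) :
    Set.BijOn (fun x : ℕ × Ideal R ↦ P.asIdeal ^ x.1 * x.2) (Set.univ ×ˢ factoredIdeals S)
      (factoredIdeals (insert P S)) := by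
  refine ⟨?_, ?_, ?_⟩
  · rintro ⟨k, J⟩ ⟨-, hJ0, hJ⟩
    refine ⟨mul_ne_zero (pow_ne_zero _ P.ne_bot) hJ0, fun Q hQ ↦ ?_⟩
    rcases Q.prime.dvd_or_dvd hQ with h | h
    · have h := Ideal.dvd_iff_le.mp (Q.prime.dvd_of_dvd_pow h)
      simp [HeightOneSpectrum.ext (P.isMaximal.eq_of_le Q.isPrime.ne_top h).symm]
    · exact Finset.mem_insert_of_mem (hJ Q h)
  · rintro ⟨k, J⟩ ⟨-, hJ0, hJ⟩ ⟨l, I⟩ ⟨-, hI0, hI⟩ h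
    have hJP : ¬ P.asIdeal ∣ J := fun h ↦ hP (hJ P h)
    have hIP : ¬ P.asIdeal ∣ I := fun h ↦ hP (hI P h)
    have hkl := congrArg (emultiplicity P.asIdeal) h
    simp only [emultiplicity_mul P.prime, emultiplicity_pow_self P.ne_bot P.prime.not_isUnit,
      emultiplicity_eq_zero.mpr hJP, emultiplicity_eq_zero.mpr hIP, add_zero, Nat.cast_inj] at hkl
    subst hkl
    exact congrArg (Prod.mk k) (mul_left_cancel₀ (pow_ne_zero k P.ne_bot) h)
  · rintro I ⟨hI0, hI⟩
    obtain ⟨J, hJ, hJP⟩ :=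
      (FiniteMultiplicity.of_prime_left P.prime hI0).exists_eq_pow_mul_and_not_dvd
    refine ⟨(multiplicity P.asIdeal I, J), ⟨trivial, ?_, fun Q hQ ↦ ?_⟩, hJ.symm⟩
    · rintro rfl
      exact hJP (dvd_zero _)
    · rcases Finset.mem_insert.mp (hI Q (hJ ▸ hQ.mul_left _)) with rfl | h
      exacts [absurd hQ hJP, h]

theorem hasSum_factoredIdeals (g : Ideal R →* ℂ) (hg : ∀ P : HeightOneSpectrum R, ‖g P.asIdeal‖ < 1)
    (S : Finset (HeightOneSpectrum R)) :
    Summable (fun I : factoredIdeals S ↦ ‖g I‖) ∧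
      HasSum (fun I : factoredIdeals S ↦ g I) (∏ P ∈ S, (1 - g P.asIdeal)⁻¹) := by
  classical
  induction S using Finset.induction with
  | empty =>
    rw [factoredIdeals_empty]
    have h := hasSum_singleton (1 : Ideal R) g
    rw [map_one] at h
    rw [Finset.prod_empty]
    exact ⟨(Set.finite_singleton 1).summable (‖g ·‖), h⟩
  | insert P S hP ih =>
    let e : ℕ × factoredIdeals S ≃ factoredIdeals (insert P S) :=
      ((Equiv.Set.univ ℕ).symm.prodCongr (Equiv.refl _)).trans
        ((Equiv.Set.prod _ _).symm.trans (bijOn_factoredIdeals_insert S hP).equiv)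
    have he : ∀ x, (e x : Ideal R) = P.asIdeal ^ x.1 * x.2 := fun x ↦ rfl
    have hgeo : Summable (fun n : ℕ ↦ ‖g P.asIdeal ^ n‖) := by
      simpa using summable_geometric_of_lt_one (norm_nonneg _) (hg P)
    constructor
    · simp only [← e.summable_iff, Function.comp_def, he, map_mul, map_pow, norm_mul]
      exact Summable.mul_of_nonneg hgeo ih.1 (fun n ↦ norm_nonneg _) (fun n ↦ norm_nonneg _)
    · simp only [Finset.prod_insert hP, ← e.hasSum_iff, Function.comp_def, he, map_mul, map_pow]
      have hmul : Summable (fun x : ℕ × factoredIdeals S ↦ g P.asIdeal ^ x.1 * g x.2) := by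
        apply summable_mul_of_summable_norm (f := fun n : ℕ ↦ g P.asIdeal ^ n)
          (g := fun I : factoredIdeals S ↦ g I) hgeo ih.1
      apply HasSum.mul (f := fun n : ℕ ↦ g P.asIdeal ^ n) (g := fun I : factoredIdeals S ↦ g I)
        (hasSum_geometric_of_norm_lt_one (hg P)) ih.2 hmul

theorem hasProd_one_sub_inv_of_summable (g : Ideal R →*₀ ℂ) (hsum : Summable (fun I ↦ ‖g I‖)) :
    HasProd (fun P : HeightOneSpectrum R ↦ (1 - g P.asIdeal)⁻¹) (∑' I, g I) := by
  have hg : ∀ P : HeightOneSpectrum R, ‖g P.asIdeal‖ < 1 := fun P ↦ by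
    have hinj : Function.Injective (fun n : ℕ ↦ P.asIdeal ^ n) :=
      pow_injective_of_not_isUnit P.prime.not_isUnit P.ne_bot
    have := hsum.comp_injective hinj
    simp only [Function.comp_def, map_pow, norm_pow] at this
    simpa using summable_geometric_iff_norm_lt_one.mp this
  rw [HasProd]
  have key : ∀ S : Finset (HeightOneSpectrum R), ∏ P ∈ S, (1 - g P.asIdeal)⁻¹ =
      ∑' I, (factoredIdeals S).indicator g I := fun S ↦ by
    rw [← tsum_subtype]
    exact (hasSum_factoredIdeals (g : Ideal R →* ℂ) hg S).2.tsum_eq.symm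
  simp only [key]
  refine tendsto_tsum_of_dominated_convergence (bound := fun I ↦ ‖g I‖) hsum (fun I ↦ ?_)
    (Eventually.of_forall fun S I ↦ norm_indicator_le_norm_self _ _)
  by_cases hI : I = ⊥
  · subst hI
    have : g ⊥ = 0 := map_zero g
    simp [show ∀ S : Finset (HeightOneSpectrum R), (factoredIdeals S).indicator g ⊥ = 0 from
      fun S ↦ Set.indicator_of_notMem (fun h ↦ h.1 rfl) _, this]
  · refine tendsto_const_nhds.congr' ?_
    filter_upwards [eventually_ge_atTop (Ideal.finite_factors hI).toFinset] with S hS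
    rw [Set.indicator_of_mem]
    exact ⟨hI, fun P hP ↦ hS (by simpa using hP)⟩

end IdealEulerProduct

section DedekindZeta

open IsDedekindDomain NumberField Filter Topology

variable (K : Type*) [Field K] [NumberField K]

theorem LSeriesSummable_card_absNorm {s : ℝ} (hs : 1 < s) :
    LSeriesSummable (fun n ↦ (Nat.card {I : Ideal (𝓞 K) // Ideal.absNorm I = n} : ℂ)) s := by
  have hlim : Tendsto (fun n : ℕ ↦ (∑ k ∈ Finset.Icc 1 n,
      (Nat.card {I : Ideal (𝓞 K) // Ideal.absNorm I = k} : ℝ)) / n) atTop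
      (𝓝 (dedekindZeta_residue K)) := by
    refine ((Ideal.tendsto_norm_le_div_atTop₀ K).comp tendsto_natCast_atTop_atTop).congr fun n ↦ ?_
    simp only [Function.comp_apply, Nat.cast_le, ← Nat.cast_sum]
    congr
    rw [← add_left_inj 1, ← Ideal.card_norm_le_eq_card_norm_le_add_one,
      show Finset.Icc 1 n = Finset.Ioc 0 n from Finset.Icc_succ_left_eq_Ioc _ _,
      show 1 = Nat.card {I : Ideal (𝓞 K) // Ideal.absNorm I = 0} by
        simp [Ideal.absNorm_eq_zero_iff],
      Finset.sum_Ioc_add_eq_sum_Icc (n.zero_le),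
      ← Finset.card_preimage_eq_sum_card_image_eq
        (fun k _ ↦ Ideal.finite_setOfPred_absNorm_eq k)]
    simp [Set.coe_eq_subtype]
  have hO : (fun n : ℕ ↦ ∑ k ∈ Finset.Icc 1 n,
      (Nat.card {I : Ideal (𝓞 K) // Ideal.absNorm I = k} : ℝ)) =O[atTop]
      fun n ↦ (n : ℝ) ^ (1 : ℝ) := by
    simp only [Real.rpow_one]
    refine Asymptotics.isBigO_of_div_tendsto_nhds ?_ _ hlim
    filter_upwards [eventually_ne_atTop 0] with n hn h
    exact absurd (by exact_mod_cast h) hn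
  simpa using LSeriesSummable_of_sum_norm_bigO_and_nonneg hO (fun _ ↦ Nat.cast_nonneg _)
    zero_le_one (s := (s : ℂ)) (by simpa using hs)

theorem dedekindZeta_hasProd {s : ℝ} (hs : 1 < s) :
    HasProd (fun P : HeightOneSpectrum (𝓞 K) ↦
      (1 - (Ideal.absNorm P.asIdeal : ℂ) ^ (-(s : ℂ)))⁻¹) (dedekindZeta K s) := by
  have hs0 : -(s : ℂ) ≠ 0 := by
    rw [neg_ne_zero]
    exact_mod_cast (zero_lt_one.trans hs).ne'
  let g : Ideal (𝓞 K) →*₀ ℂ :=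
    { toFun := fun I ↦ (Ideal.absNorm I : ℂ) ^ (-(s : ℂ))
      map_zero' := by simp [Complex.zero_cpow hs0]
      map_one' := by simp
      map_mul' := fun I J ↦ by
        simp only [map_mul, Nat.cast_mul]
        exact Complex.natCast_mul_natCast_cpow _ _ _ }
  have hfin : ∀ n : ℕ, Finite {I : Ideal (𝓞 K) // Ideal.absNorm I = n} :=
    fun n ↦ Ideal.finite_setOfPred_absNorm_eq n
  let e := Equiv.sigmaFiberEquiv (fun I : Ideal (𝓞 K) ↦ Ideal.absNorm I)
  have hterm : ∀ n : ℕ, ∑' I : {I : Ideal (𝓞 K) // Ideal.absNorm I = n}, g I.1 =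
      LSeries.term (fun n ↦ (Nat.card {I : Ideal (𝓞 K) // Ideal.absNorm I = n} : ℂ)) s n := by
    intro n
    have := Fintype.ofFinite {I : Ideal (𝓞 K) // Ideal.absNorm I = n}
    have h1 : ∀ I : {I : Ideal (𝓞 K) // Ideal.absNorm I = n}, g I.1 = (n : ℂ) ^ (-(s : ℂ)) :=
      fun I ↦ by simp [g, I.2]
    simp only [h1, tsum_fintype, Finset.sum_const, Finset.card_univ, nsmul_eq_mul,
      ← Nat.card_eq_fintype_card, LSeries.term]
    split_ifs with hn
    · subst hn; simp [Complex.zero_cpow hs0]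
    · rw [Complex.cpow_neg, div_eq_mul_inv]
  have hsum : Summable (fun I ↦ ‖g I‖) := by
    rw [← e.summable_iff]
    refine (summable_sigma_of_nonneg fun _ ↦ norm_nonneg _).mpr ⟨fun n ↦ ?_, ?_⟩
    · have := hfin n
      exact Summable.of_finite
    · refine (LSeriesSummable_card_absNorm K hs).norm.congr fun n ↦ ?_
      have := Fintype.ofFinite {I : Ideal (𝓞 K) // Ideal.absNorm I = n}
      rw [← hterm]
      have h1 : ∀ I : {I : Ideal (𝓞 K) // Ideal.absNorm I = n}, g I.1 = (n : ℂ) ^ (-(s : ℂ)) :=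
        fun I ↦ by simp [g, I.2]
      have h2 : ∀ I : {I : Ideal (𝓞 K) // Ideal.absNorm I = n}, e ⟨n, I⟩ = I.1 := fun I ↦ rfl
      simp [h1, h2]
  have := hasProd_one_sub_inv_of_summable g hsum
  have hz : dedekindZeta K s = ∑' I, g I := by
    change LSeries _ _ = _
    rw [LSeries, ← e.tsum_eq, Summable.tsum_sigma]
    · exact tsum_congr fun n ↦ (hterm n).symm
    · exact e.summable_iff.mpr hsum.of_norm
  rw [hz]
  exact this

end DedekindZeta

section RationalPrimes

open IsDedekindDomain NumberField Filter Topology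

variable (K : Type*) [Field K]

/-- The rational prime below a nonzero prime of a number field. -/
noncomputable def primeBelow (P : HeightOneSpectrum (𝓞 K)) : Nat.Primes :=
  ⟨Ideal.absNorm (P.asIdeal.under ℤ),
    have := P.isPrime
    have : NeZero P.asIdeal := ⟨P.ne_bot⟩
    Nat.absNorm_under_prime P.asIdeal⟩

variable {K} in
theorem primeBelow_eq_iff (P : HeightOneSpectrum (𝓞 K)) (q : Nat.Primes) :
    primeBelow K P = q ↔ P.asIdeal ∈ (Ideal.span {((q : ℕ) : ℤ)}).primesOver (𝓞 K) := by
  constructor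
  · rintro rfl
    exact ⟨P.isPrime, Int.liesOver_span_absNorm P.asIdeal⟩
  · rintro ⟨_, h⟩
    apply Subtype.ext
    change Ideal.absNorm (P.asIdeal.under ℤ) = q
    rw [← h.over]
    simp

variable [NumberField K]

/-- The primes of a number field above a given rational prime. -/
noncomputable def primeBelowFiberEquiv (q : Nat.Primes) :
    {P : HeightOneSpectrum (𝓞 K) // primeBelow K P = q} ≃
      (Ideal.span {((q : ℕ) : ℤ)}).primesOver (𝓞 K) :=
  Set.BijOn.equiv HeightOneSpectrum.asIdeal
    ⟨fun P hP ↦ (primeBelow_eq_iff P q).mp hP, fun _ _ _ _ h ↦ HeightOneSpectrum.ext h,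
      fun Q hQ ↦ ⟨⟨Q, hQ.1, Ideal.ne_bot_of_mem_primesOver
        (by simpa using q.2.ne_zero) hQ⟩, (primeBelow_eq_iff _ q).mpr hQ, rfl⟩⟩

theorem dedekindZeta_hasProd_primes [IsGalois ℚ K] {s : ℝ} (hs : 1 < s) :
    HasProd (fun q : Nat.Primes ↦ ((1 - ((q : ℂ) ^ (-(s : ℂ))) ^
      (Ideal.span {((q : ℕ) : ℤ)}).inertiaDegIn (𝓞 K))⁻¹) ^
        ((Ideal.span {((q : ℕ) : ℤ)}).primesOver (𝓞 K)).ncard) (dedekindZeta K s) := by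
  have h := dedekindZeta_hasProd K hs
  rw [← (Equiv.sigmaFiberEquiv (primeBelow K)).hasProd_iff] at h
  refine h.sigma fun q ↦ ?_
  have hfin : Finite ((Ideal.span {((q : ℕ) : ℤ)}).primesOver (𝓞 K)) :=
    Algebra.QuasiFinite.finite_primesOver _
  have : Finite {P : HeightOneSpectrum (𝓞 K) // primeBelow K P = q} :=
    Finite.of_equiv _ (primeBelowFiberEquiv K q).symm
  have := Fintype.ofFinite {P : HeightOneSpectrum (𝓞 K) // primeBelow K P = q}
  have hcard : ((Ideal.span {((q : ℕ) : ℤ)}).primesOver (𝓞 K)).ncard =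
      Fintype.card {P : HeightOneSpectrum (𝓞 K) // primeBelow K P = q} := by
    rw [← Nat.card_coe_set_eq, ← Nat.card_eq_fintype_card,
      Nat.card_congr (primeBelowFiberEquiv K q)]
  have hterm : ∀ P : {P : HeightOneSpectrum (𝓞 K) // primeBelow K P = q},
      (1 - (Ideal.absNorm P.1.asIdeal : ℂ) ^ (-(s : ℂ)))⁻¹ = (1 - ((q : ℂ) ^ (-(s : ℂ))) ^
      (Ideal.span {((q : ℕ) : ℤ)}).inertiaDegIn (𝓞 K))⁻¹ := fun P ↦ by
    obtain ⟨h1, h2⟩ := (primeBelow_eq_iff P.1 q).mp P.2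
    have : (Ideal.span {((q : ℕ) : ℤ)}).IsMaximal :=
      (Ideal.span_singleton_prime (by simpa using q.2.ne_zero)).mpr
        (Nat.prime_iff_prime_int.mp q.2) |>.isMaximal (by simpa using q.2.ne_zero)
    rw [Ideal.inertiaDegIn_eq_inertiaDeg _ P.1.asIdeal Gal(K/ℚ),
      ← Ideal.pow_inertiaDeg q P.1.asIdeal, Nat.cast_pow]
    congr 2
    rw [← Complex.cpow_nat_mul, Complex.natCast_cpow_natCast_mul]
  rw [hcard, ← Finset.card_univ, ← Finset.prod_const]
  convert! hasProd_fintype _ using 1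
  refine Finset.prod_congr rfl fun P _ ↦ (hterm P).symm

end RationalPrimes

section CharacterProduct

open IsDedekindDomain NumberField Filter Topology

variable {n : ℕ} [NeZero n]

theorem prod_one_sub_dirichletCharacter_mul (a : (ZMod n)ˣ) (t : ℂ) :
    ∃ c : ℕ, c * orderOf a = n.totient ∧
      ∏ χ : DirichletCharacter ℂ n, (1 - χ a * t) = (1 - t ^ orderOf a) ^ c := by
  classical
  have hf : 0 < orderOf a := orderOf_pos a
  have : NeZero (orderOf a) := ⟨hf.ne'⟩
  have hfin : Fintype (rootsOfUnity (orderOf a) ℂ) := Fintype.ofFinite _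
  have hcard : Fintype.card (rootsOfUnity (orderOf a) ℂ) = orderOf a :=
    Nat.card_eq_fintype_card.symm.trans (Complex.card_rootsOfUnity (orderOf a))
  let ev : DirichletCharacter ℂ n →* ℂˣ :=
    { toFun := fun χ ↦ χ.toUnitHom a
      map_one' := by ext; simp
      map_mul' := fun χ ψ ↦ by ext; simp }
  have hmem : ∀ χ, ev χ ∈ rootsOfUnity (orderOf a) ℂ := fun χ ↦ by
    rw [mem_rootsOfUnity]
    change χ.toUnitHom a ^ _ = 1
    rw [← map_pow, pow_orderOf_eq_one, map_one]
  have hrange : ev.range = rootsOfUnity (orderOf a) ℂ := by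
    have hle : ev.range ≤ rootsOfUnity (orderOf a) ℂ := by
      rintro _ ⟨χ, rfl⟩
      exact hmem χ
    refine Subgroup.eq_of_le_of_card_ge hle ?_
    rw [Complex.card_rootsOfUnity]
    have : Nat.card ev.range ≠ 0 := Nat.card_pos.ne'
    refine Nat.le_of_dvd Nat.card_pos (orderOf_dvd_of_pow_eq_one ?_)
    by_contra h
    obtain ⟨χ, hχ⟩ := MulChar.exists_apply_ne_one_of_hasEnoughRootsOfUnity (ZMod n) ℂ
      (a := ((a ^ Nat.card ev.range : (ZMod n)ˣ) : ZMod n)) (by simpa [Units.ext_iff] using h)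
    apply hχ
    have h1 : ev χ ^ Nat.card ev.range = 1 := by
      have := pow_card_eq_one' (x := (⟨ev χ, χ, rfl⟩ : ev.range))
      simpa [Subtype.ext_iff] using this
    have h2 := congrArg Units.val h1
    simpa [ev] using h2
  let ev' : DirichletCharacter ℂ n →* rootsOfUnity (orderOf a) ℂ := ev.codRestrict _ hmem
  have hsurj : Function.Surjective ev' := fun y ↦ by
    obtain ⟨χ, hχ⟩ : y.1 ∈ ev.range := by rw [hrange]; exact y.2
    exact ⟨χ, Subtype.ext hχ⟩
  let c := Finset.card {χ | ev' χ = 1}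
  have hc : ∀ y, Finset.card {χ | ev' χ = y} = c := fun y ↦
    MonoidHom.card_fiber_eq_of_mem_range ev' (hsurj y) (hsurj 1)
  refine ⟨c, ?_, ?_⟩
  · have h := Finset.card_eq_sum_card_fiberwise (f := ev') (s := Finset.univ) (t := Finset.univ)
      (fun _ _ ↦ Finset.mem_coe.mpr (Finset.mem_univ _))
    simp only [hc, Finset.sum_const, Finset.card_univ, hcard, smul_eq_mul] at h
    rw [mul_comm, ← h, ← Nat.card_eq_fintype_card,
      DirichletCharacter.card_eq_totient_of_hasEnoughRootsOfUnity]
  · have h1 : ∀ χ : DirichletCharacter ℂ n, 1 - χ a * t = 1 - ((ev' χ : ℂˣ) : ℂ) * t :=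
      fun χ ↦ by simp [ev', ev]
    simp only [h1]
    rw [← Finset.prod_fiberwise (s := Finset.univ) (g := ev')]
    have h2 : ∀ y, ∏ χ with ev' χ = y, (1 - ((ev' χ : ℂˣ) : ℂ) * t) =
        (1 - ((y : ℂˣ) : ℂ) * t) ^ c := fun y ↦ by
      rw [← hc y, ← Finset.prod_const]
      refine Finset.prod_congr rfl fun χ hχ ↦ ?_
      rw [(Finset.mem_filter.mp hχ).2]
    simp only [h2]
    rw [Finset.prod_pow]
    congr 1
    have h3 := (Complex.isPrimitiveRoot_exp (orderOf a) hf.ne').pow_sub_pow_eq_prod_sub_mul 1 t hf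
    rw [one_pow] at h3
    rw [h3]
    refine Finset.prod_bij (fun y _ ↦ ((y : ℂˣ) : ℂ)) (fun y _ ↦ ?_) (fun x _ y _ h ↦ ?_)
      (fun z hz ↦ ?_) (fun _ _ ↦ rfl)
    · rw [Polynomial.mem_nthRootsFinset hf]
      simpa using congrArg Units.val ((mem_rootsOfUnity _ _).mp y.2)
    · exact Subtype.ext (Units.ext h)
    · rw [Polynomial.mem_nthRootsFinset hf] at hz
      exact ⟨rootsOfUnity.mkOfPowEq z hz, Finset.mem_univ _, rfl⟩

end CharacterProduct

section CyclotomicZeta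

open IsDedekindDomain NumberField Filter Topology

variable (n : ℕ) [NeZero n] (K : Type*) [Field K] [NumberField K] [IsCyclotomicExtension {n} ℚ K]

/-- The reciprocal of the Euler factor at the rational prime `q` of the Dedekind zeta function. -/
noncomputable def localZeta (q : ℕ) (s : ℂ) : ℂ :=
  ((1 - ((q : ℂ) ^ (-s)) ^ (Ideal.span {(q : ℤ)}).inertiaDegIn (𝓞 K))⁻¹) ^
    ((Ideal.span {(q : ℤ)}).primesOver (𝓞 K)).ncard

theorem localZeta_eq_prod (q : ℕ) [hq : Fact q.Prime] (hqn : ¬ q ∣ n) (s : ℂ) :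
    localZeta K q s = ∏ χ : DirichletCharacter ℂ n, (1 - χ q * (q : ℂ) ^ (-s))⁻¹ := by
  have : IsGalois ℚ K := IsCyclotomicExtension.isGalois {n} ℚ K
  have hcop : q.Coprime n := (Nat.Prime.coprime_iff_not_dvd hq.out).mpr hqn
  obtain ⟨c, hc, h⟩ := prod_one_sub_dirichletCharacter_mul (ZMod.unitOfCoprime q hcop)
    ((q : ℂ) ^ (-s))
  have ho : orderOf (ZMod.unitOfCoprime q hcop) = orderOf (q : ZMod n) := by
    rw [← orderOf_units, ZMod.coe_unitOfCoprime]
  rw [Finset.prod_inv_distrib]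
  simp only [ZMod.coe_unitOfCoprime] at h
  rw [h, localZeta, IsCyclotomicExtension.Rat.inertiaDegIn_eq_of_not_dvd q K hqn, ho, inv_pow]
  congr 2
  have hmax : (Ideal.span {(q : ℤ)}).IsMaximal :=
      (Ideal.span_singleton_prime (by simpa using hq.out.ne_zero)).mpr
        (Nat.prime_iff_prime_int.mp hq.out) |>.isMaximal (by simpa using hq.out.ne_zero)
  have h2 := Ideal.ncard_primesOver_mul_ramificationIdxIn_mul_inertiaDegIn
    (Ideal.span {(q : ℤ)}) (𝓞 K) Gal(K/ℚ)
  rw [IsCyclotomicExtension.Rat.ramificationIdxIn_eq_of_not_dvd q K hqn,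
    IsCyclotomicExtension.Rat.inertiaDegIn_eq_of_not_dvd q K hqn, one_mul,
    IsGalois.card_aut_eq_finrank, IsCyclotomicExtension.Rat.finrank n K, ← hc, ho] at h2
  exact Nat.eq_of_mul_eq_mul_right (ho ▸ orderOf_pos _) h2

theorem dedekindZeta_eq_prod_LSeries {s : ℝ} (hs : 1 < s) :
    dedekindZeta K s = (∏ χ : DirichletCharacter ℂ n, χ.LFunction s) *
      ∏ q ∈ n.primeFactors, localZeta K q s := by
  have : IsGalois ℚ K := IsCyclotomicExtension.isGalois {n} ℚ K
  have hs' : 1 < (s : ℂ).re := by simpa using hs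
  have h1 : HasProd (fun q : Nat.Primes ↦
      ∏ χ : DirichletCharacter ℂ n, (1 - χ q * ((q : ℕ) : ℂ) ^ (-(s : ℂ)))⁻¹)
      (∏ χ : DirichletCharacter ℂ n, χ.LFunction s) := by
    refine hasProd_prod fun χ _ ↦ ?_
    rw [DirichletCharacter.LFunction_eq_LSeries χ hs']
    exact DirichletCharacter.LSeries_eulerProduct_hasProd χ hs'
  let F : Finset Nat.Primes := n.primeFactors.subtype Nat.Prime
  have h2 : HasProd (fun q : Nat.Primes ↦ if (q : ℕ) ∣ n then localZeta K q s else 1)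
      (∏ q ∈ F, if (q : ℕ) ∣ n then localZeta K q s else 1) :=
    hasProd_prod_of_ne_finset_one fun q hq ↦ if_neg fun h ↦ hq
      (Finset.mem_subtype.mpr (Nat.mem_primeFactors.mpr ⟨q.2, h, NeZero.ne n⟩))
  have h3 := dedekindZeta_hasProd_primes K hs
  have h4 : ∏ q ∈ F, (if (q : ℕ) ∣ n then localZeta K q s else 1) =
      ∏ q ∈ n.primeFactors, localZeta K q s := by
    refine (Finset.prod_subtype_of_mem (p := Nat.Prime)
      (fun q ↦ if q ∣ n then localZeta K q s else 1)
      fun q hq ↦ Nat.prime_of_mem_primeFactors hq).trans ?_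
    exact Finset.prod_congr rfl fun q hq ↦ if_pos (Nat.dvd_of_mem_primeFactors hq)
  rw [← h4]
  refine HasProd.unique h3 ?_
  convert h1.mul h2 using 2 with q
  have : Fact (q : ℕ).Prime := ⟨q.2⟩
  change localZeta K q s = _
  split_ifs with hq
  · have : ∀ χ : DirichletCharacter ℂ n, χ (q : ℕ) = 0 := fun χ ↦ χ.map_nonunit fun h ↦
      q.2.coprime_iff_not_dvd.mp ((ZMod.isUnit_iff_coprime _ _).mp h) hq
    simp [this]
  · rw [mul_one, localZeta_eq_prod n K q hq]

end CyclotomicZeta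

section Residue

open IsDedekindDomain NumberField Filter Topology

variable (n : ℕ) [NeZero n] (K : Type*) [Field K] [NumberField K]

theorem continuousAt_localZeta [IsGalois ℚ K] {q : ℕ} (hq : q.Prime) :
    ContinuousAt (localZeta K q) 1 := by
  have hmax : (Ideal.span {(q : ℤ)}).IsMaximal :=
      (Ideal.span_singleton_prime (by simpa using hq.ne_zero)).mpr
        (Nat.prime_iff_prime_int.mp hq) |>.isMaximal (by simpa using hq.ne_zero)
  have hq0 : (q : ℂ) ≠ 0 := by exact_mod_cast hq.ne_zero
  have hf : (Ideal.span {(q : ℤ)}).inertiaDegIn (𝓞 K) ≠ 0 :=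
    Ideal.inertiaDegIn_ne_zero Gal(K/ℚ)
  unfold localZeta
  refine ContinuousAt.pow (ContinuousAt.inv₀ ?_ ?_) _
  · exact continuousAt_const.sub ((ContinuousAt.const_cpow continuousAt_neg (.inl hq0)).pow _)
  · rw [Complex.cpow_neg_one, sub_ne_zero]
    intro h
    have h1 := congrArg norm h
    rw [norm_one, norm_pow, norm_inv, Complex.norm_natCast] at h1
    exact (pow_lt_one₀ (by positivity) (inv_lt_one_of_one_lt₀ (by exact_mod_cast hq.one_lt)) hf).ne'
      h1

theorem dedekindZeta_residue_eq_prod [IsCyclotomicExtension {n} ℚ K]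
    [DecidableEq (DirichletCharacter ℂ n)] :
    (dedekindZeta_residue K : ℂ) = (∏ p ∈ n.primeFactors, (1 - (p : ℂ)⁻¹)) *
      (∏ χ ∈ ({1}ᶜ : Finset (DirichletCharacter ℂ n)), χ.LFunction 1) *
        ∏ q ∈ n.primeFactors, localZeta K q 1 := by
  have : IsGalois ℚ K := IsCyclotomicExtension.isGalois {n} ℚ K
  have h1 : Tendsto (fun s : ℝ ↦ (s : ℂ)) (𝓝[>] 1) (𝓝[≠] 1) := by
    refine tendsto_nhdsWithin_iff.mpr ⟨?_, ?_⟩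
    · exact (Complex.continuous_ofReal.tendsto' 1 1 (by simp)).mono_left nhdsWithin_le_nhds
    · filter_upwards [self_mem_nhdsWithin] with s hs
      simpa using (show s ≠ 1 from ne_of_gt hs)
  refine tendsto_nhds_unique (tendsto_sub_one_mul_dedekindZeta_nhdsGT K) ?_
  have h2 := (DirichletCharacter.LFunctionTrivChar_residue_one (N := n)).comp h1
  have h3 : Tendsto (fun s : ℝ ↦ ∏ χ ∈ ({1}ᶜ : Finset (DirichletCharacter ℂ n)), χ.LFunction s)
      (𝓝[>] 1) (𝓝 (∏ χ ∈ ({1}ᶜ : Finset (DirichletCharacter ℂ n)), χ.LFunction 1)) := by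
    refine tendsto_finsetProd _ fun χ hχ ↦ ?_
    have hχ : χ ≠ 1 := by simpa using hχ
    exact ((DirichletCharacter.differentiable_LFunction hχ).continuous.tendsto 1).comp
      (h1.mono_right nhdsWithin_le_nhds)
  have h4 : Tendsto (fun s : ℝ ↦ ∏ q ∈ n.primeFactors, localZeta K q s)
      (𝓝[>] 1) (𝓝 (∏ q ∈ n.primeFactors, localZeta K q 1)) :=
    tendsto_finsetProd _ fun q hq ↦
      (continuousAt_localZeta K (Nat.prime_of_mem_primeFactors hq)).tendsto.comp
        (h1.mono_right nhdsWithin_le_nhds)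
  refine ((h2.mul h3).mul h4).congr' ?_
  filter_upwards [self_mem_nhdsWithin] with s hs
  rw [dedekindZeta_eq_prod_LSeries n K hs, ← Finset.prod_mul_prod_compl {1}, Finset.prod_singleton,
    Function.comp_apply, mul_assoc, mul_assoc, mul_assoc]

end Residue

section Level57

open IsDedekindDomain NumberField Filter Topology

open DirichletCharacter

instance fact_prime_nineteen : Fact (Nat.Prime 19) := ⟨by norm_num⟩

/-- The quadratic character modulo `3`, with complex values. -/
noncomputable def chi3 : DirichletCharacter ℂ 3 :=
  (quadraticChar (ZMod 3)).ringHomComp (Int.castRingHom ℂ)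

theorem chi3_apply (a : ZMod 3) : chi3 a = (quadraticChar (ZMod 3) a : ℂ) := rfl

theorem chi3_two : chi3 2 = -1 := by
  rw [chi3_apply, show quadraticChar (ZMod 3) 2 = -1 by decide]
  simp

theorem chi3_neg_one : chi3 (-1) = -1 := chi3_two

theorem chi3_ne_one : chi3 ≠ 1 := fun h ↦ by
  have := chi3_two
  rw [h, MulChar.one_apply (by decide)] at this
  norm_num at this

theorem dirichletCharacter_three_ext {χ ψ : DirichletCharacter ℂ 3} (h : χ 2 = ψ 2) : χ = ψ := by
  refine MulChar.ext' fun a ↦ ?_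
  fin_cases a
  · exact (χ.map_nonunit not_isUnit_zero).trans (ψ.map_nonunit not_isUnit_zero).symm
  · exact (map_one χ).trans (map_one ψ).symm
  · exact h

theorem univ_dirichletCharacter_three [DecidableEq (DirichletCharacter ℂ 3)] :
    (Finset.univ : Finset (DirichletCharacter ℂ 3)) = {1, chi3} := by
  ext χ
  simp only [Finset.mem_univ, Finset.mem_insert, Finset.mem_singleton, true_iff]
  have h : χ 2 * χ 2 = 1 := by
    rw [← map_mul, show (2 : ZMod 3) * 2 = 1 by decide, map_one]
  rcases mul_self_eq_one_iff.mp h with h | h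
  · exact .inl (dirichletCharacter_three_ext (by rw [h, MulChar.one_apply (by decide)]))
  · exact .inr (dirichletCharacter_three_ext (by rw [h, chi3_two]))

theorem exists_eq_two_pow (a : ZMod 19) (ha : a ≠ 0) : ∃ k : ℕ, k < 18 ∧ a = 2 ^ k := by
  revert a
  decide

theorem dirichletCharacter_nineteen_ext {χ ψ : DirichletCharacter ℂ 19} (h : χ 2 = ψ 2) :
    χ = ψ := by
  refine MulChar.ext fun a ↦ ?_
  obtain ⟨k, -, hk⟩ := exists_eq_two_pow a a.ne_zero
  rw [hk, map_pow, map_pow, h]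

/-- The character modulo `57` obtained from characters modulo `3` and `19`. -/
noncomputable def char57 (α : DirichletCharacter ℂ 3) (β : DirichletCharacter ℂ 19) :
    DirichletCharacter ℂ 57 :=
  changeLevel (by norm_num) α * changeLevel (by norm_num) β

theorem char57_apply_of_coprime (α : DirichletCharacter ℂ 3) (β : DirichletCharacter ℂ 19) {a : ℕ}
    (ha : a.Coprime 57) : char57 α β a = α a * β a := by
  rw [char57, MulChar.mul_apply, ← ZMod.coe_unitOfCoprime a ha, changeLevel_eq_cast_of_dvd,
    changeLevel_eq_cast_of_dvd, ZMod.coe_unitOfCoprime, ZMod.cast_natCast (by norm_num),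
    ZMod.cast_natCast (by norm_num)]

theorem char57_injective : Function.Injective
    (fun x : DirichletCharacter ℂ 3 × DirichletCharacter ℂ 19 ↦ char57 x.1 x.2) := by
  rintro ⟨α, β⟩ ⟨α', β'⟩ h
  have h20 := DFunLike.congr_fun h ((20 : ℕ) : ZMod 57)
  have h40 := DFunLike.congr_fun h ((40 : ℕ) : ZMod 57)
  simp only at h20 h40
  rw [char57_apply_of_coprime _ _ (by norm_num), char57_apply_of_coprime _ _ (by norm_num)]
    at h20 h40
  rw [show ((20 : ℕ) : ZMod 3) = 2 by decide, show ((20 : ℕ) : ZMod 19) = 1 by decide,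
    map_one, map_one, mul_one, mul_one] at h20
  rw [show ((40 : ℕ) : ZMod 3) = 1 by decide, show ((40 : ℕ) : ZMod 19) = 2 by decide,
    map_one, map_one, one_mul, one_mul] at h40
  rw [dirichletCharacter_three_ext h20, dirichletCharacter_nineteen_ext h40]

theorem char57_bijective : Function.Bijective
    (fun x : DirichletCharacter ℂ 3 × DirichletCharacter ℂ 19 ↦ char57 x.1 x.2) := by
  refine (Fintype.bijective_iff_injective_and_card _).mpr ⟨char57_injective, ?_⟩
  rw [← Nat.card_eq_fintype_card, ← Nat.card_eq_fintype_card, Nat.card_prod,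
    card_eq_totient_of_hasEnoughRootsOfUnity, card_eq_totient_of_hasEnoughRootsOfUnity,
    card_eq_totient_of_hasEnoughRootsOfUnity]
  decide

theorem char57_one_one : char57 1 1 = 1 := by simp [char57]

open Classical in
theorem prod_dirichletCharacter_57 (F : DirichletCharacter ℂ 57 → ℂ) :
    ∏ χ ∈ ({1}ᶜ : Finset (DirichletCharacter ℂ 57)), F χ = F (char57 chi3 1) *
      ((∏ β ∈ ({1}ᶜ : Finset (DirichletCharacter ℂ 19)), F (char57 1 β)) *
      ∏ β ∈ ({1}ᶜ : Finset (DirichletCharacter ℂ 19)), F (char57 chi3 β)) := by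
  have h1 : ∀ (n : ℕ) [NeZero n] (F : DirichletCharacter ℂ n → ℂ),
      ∏ χ ∈ ({1}ᶜ : Finset (DirichletCharacter ℂ n)), F χ =
      ∏ χ, if χ = 1 then 1 else F χ := fun n _ F ↦ by
    rw [← Finset.prod_mul_prod_compl {1}, Finset.prod_singleton, if_pos rfl, one_mul]
    exact Finset.prod_congr rfl fun χ hχ ↦ (if_neg (by simpa using hχ)).symm
  have hne : ∀ α β, (char57 α β = 1 ↔ α = 1 ∧ β = 1) := fun α β ↦ by
    rw [← char57_one_one]
    exact (char57_injective.eq_iff (a := (α, β)) (b := (1, 1))).trans Prod.mk_inj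
  rw [h1, ← char57_bijective.prod_comp, Fintype.prod_prod_type, univ_dirichletCharacter_three,
    Finset.prod_pair chi3_ne_one.symm]
  simp only [hne, chi3_ne_one, true_and, false_and, if_false]
  rw [← h1, ← Finset.prod_mul_prod_compl {1} fun β ↦ F (char57 chi3 β), Finset.prod_singleton]
  ring

theorem orderOf_three_nineteen : orderOf (3 : ZMod 19) = 18 :=
  (orderOf_eq_iff (by norm_num)).mpr ⟨by decide, by decide⟩

open Classical in
theorem prod_one_sub_nineteen :
    ∏ β ∈ ({1}ᶜ : Finset (DirichletCharacter ℂ 19)), (1 - β 3 * (3 : ℂ)⁻¹) =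
      (1 - ((3 : ℂ)⁻¹) ^ 18) * (3 / 2) := by
  obtain ⟨c, hc, h⟩ := prod_one_sub_dirichletCharacter_mul
    (ZMod.unitOfCoprime 3 (by norm_num) : (ZMod 19)ˣ) (3 : ℂ)⁻¹
  have ho : orderOf (ZMod.unitOfCoprime 3 (by norm_num) : (ZMod 19)ˣ) = 18 := by
    rw [← orderOf_units, ZMod.coe_unitOfCoprime]
    exact orderOf_three_nineteen
  have hc1 : c = 1 := by
    rw [ho, show Nat.totient 19 = 18 by decide] at hc
    omega
  rw [ho, hc1, pow_one, ← Finset.prod_mul_prod_compl {1}, Finset.prod_singleton,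
    MulChar.one_apply (Units.isUnit _), ZMod.coe_unitOfCoprime] at h
  rw [← h]
  push_cast
  ring

variable (K : Type*) [Field K] [NumberField K] [IsCyclotomicExtension {57} ℚ K]

theorem localZeta_three : localZeta K 3 1 = (1 - ((3 : ℂ)⁻¹) ^ 18)⁻¹ := by
  have : IsGalois ℚ K := IsCyclotomicExtension.isGalois {57} ℚ K
  have hmax : (Ideal.span {((3 : ℕ) : ℤ)}).IsMaximal :=
      (Ideal.span_singleton_prime (by norm_num)).mpr
        (Nat.prime_iff_prime_int.mp Nat.prime_three) |>.isMaximal (by simp)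
  have hf : (Ideal.span {((3 : ℕ) : ℤ)}).inertiaDegIn (𝓞 K) = 18 :=
    (IsCyclotomicExtension.Rat.inertiaDegIn_eq 57 K (p := 3) (k := 0) (m := 19) (by norm_num)
      (by norm_num)).trans orderOf_three_nineteen
  have he : (Ideal.span {((3 : ℕ) : ℤ)}).ramificationIdxIn (𝓞 K) = 2 :=
    IsCyclotomicExtension.Rat.ramificationIdxIn_eq 57 K (p := 3) (k := 0) (m := 19) (by norm_num)
      (by norm_num)
  have h := Ideal.ncard_primesOver_mul_ramificationIdxIn_mul_inertiaDegIn
    (Ideal.span {((3 : ℕ) : ℤ)}) (𝓞 K) Gal(K/ℚ)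
  rw [IsGalois.card_aut_eq_finrank, IsCyclotomicExtension.Rat.finrank 57 K, hf, he,
    show Nat.totient 57 = 36 by decide] at h
  rw [localZeta, hf, show ((Ideal.span {((3 : ℕ) : ℤ)}).primesOver (𝓞 K)).ncard = 1 by omega,
    Complex.cpow_neg_one, pow_one]
  norm_num

theorem localZeta_nineteen : localZeta K 19 1 = (19 / 18) ^ 2 := by
  have : IsGalois ℚ K := IsCyclotomicExtension.isGalois {57} ℚ K
  have hmax : (Ideal.span {((19 : ℕ) : ℤ)}).IsMaximal :=
      (Ideal.span_singleton_prime (by norm_num)).mpr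
        (Nat.prime_iff_prime_int.mp (by norm_num)) |>.isMaximal (by simp)
  have hf : (Ideal.span {((19 : ℕ) : ℤ)}).inertiaDegIn (𝓞 K) = 1 :=
    (IsCyclotomicExtension.Rat.inertiaDegIn_eq 57 K (p := 19) (k := 0) (m := 3) (by norm_num)
      (by norm_num)).trans (orderOf_eq_one_iff.mpr (by decide))
  have he : (Ideal.span {((19 : ℕ) : ℤ)}).ramificationIdxIn (𝓞 K) = 18 :=
    IsCyclotomicExtension.Rat.ramificationIdxIn_eq 57 K (p := 19) (k := 0) (m := 3) (by norm_num)
      (by norm_num)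
  have h := Ideal.ncard_primesOver_mul_ramificationIdxIn_mul_inertiaDegIn
    (Ideal.span {((19 : ℕ) : ℤ)}) (𝓞 K) Gal(K/ℚ)
  rw [IsGalois.card_aut_eq_finrank, IsCyclotomicExtension.Rat.finrank 57 K, hf, he,
    show Nat.totient 57 = 36 by decide] at h
  rw [localZeta, hf, show ((Ideal.span {((19 : ℕ) : ℤ)}).primesOver (𝓞 K)).ncard = 2 by omega,
    Complex.cpow_neg_one, pow_one]
  norm_num

open Classical in
theorem dedekindZeta_residue_57 :
    (dedekindZeta_residue K : ℂ) = chi3.LFunction 1 *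
      ((∏ β ∈ ({1}ᶜ : Finset (DirichletCharacter ℂ 19)), β.LFunction 1) *
      ∏ β ∈ ({1}ᶜ : Finset (DirichletCharacter ℂ 19)), (char57 chi3 β).LFunction 1) := by
  have hp : Nat.primeFactors 57 = {3, 19} := by
    rw [show 57 = 3 * 19 by norm_num, Nat.primeFactors_mul (by norm_num) (by norm_num),
      Nat.Prime.primeFactors (by norm_num), Nat.Prime.primeFactors (by norm_num)]
    rfl
  have h3 : (char57 chi3 1).LFunction 1 = chi3.LFunction 1 * (18 / 19) := by
    rw [char57, map_one, mul_one, LFunction_changeLevel _ _ (.inl chi3_ne_one), hp,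
      Finset.prod_pair (by norm_num), show chi3 ((3 : ℕ) : ZMod 3) = 0 from
      chi3.map_nonunit not_isUnit_zero, show chi3 ((19 : ℕ) : ZMod 3) = 1 from map_one chi3,
      Complex.cpow_neg_one, Complex.cpow_neg_one]
    norm_num
  have h19 : ∏ β ∈ ({1}ᶜ : Finset (DirichletCharacter ℂ 19)), (char57 1 β).LFunction 1 =
      (∏ β ∈ ({1}ᶜ : Finset (DirichletCharacter ℂ 19)), β.LFunction 1) *
        ((1 - ((3 : ℂ)⁻¹) ^ 18) * (3 / 2)) := by
    rw [← prod_one_sub_nineteen, ← Finset.prod_mul_distrib]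
    refine Finset.prod_congr rfl fun β hβ ↦ ?_
    rw [char57, map_one, one_mul, LFunction_changeLevel _ _ (.inl (by simpa using hβ)), hp,
      Finset.prod_pair (by norm_num), show β ((19 : ℕ) : ZMod 19) = 0 from
      β.map_nonunit not_isUnit_zero, Complex.cpow_neg_one, Complex.cpow_neg_one]
    norm_num
  rw [dedekindZeta_residue_eq_prod 57 K, prod_dirichletCharacter_57, h3, h19, hp,
    Finset.prod_pair (by norm_num), Finset.prod_pair (by norm_num), localZeta_three,
    localZeta_nineteen]
  have h0 : (1 - ((3 : ℂ)⁻¹) ^ 18) ≠ 0 := by norm_num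
  push_cast
  generalize (1 - ((3 : ℂ)⁻¹) ^ 18) = x at h0 ⊢
  field_simp
  ring

end Level57

section ExpZetaOne

open Filter Topology

theorem one_sub_mul_tsum {x : ℂ} {b : ℕ → ℂ} (h : Summable fun n ↦ x ^ n * b n) :
    (1 - x) * ∑' n, x ^ n * b n = b 0 + ∑' n, x ^ (n + 1) * (b (n + 1) - b n) := by
  have h1 : Summable fun n ↦ x ^ (n + 1) * b (n + 1) := (summable_nat_add_iff 1).mpr h
  have h2 : Summable fun n ↦ x ^ (n + 1) * b n :=
    (h.mul_left x).congr fun n ↦ by ring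
  have h3 : ∑' n, x ^ (n + 1) * b n = x * ∑' n, x ^ n * b n := by
    rw [← tsum_mul_left]
    exact tsum_congr fun n ↦ by ring
  simp only [mul_sub]
  rw [h1.tsum_sub h2, h3, sub_mul, one_mul, h.tsum_eq_zero_add]
  ring

theorem tendsto_one_sub_mul_tsum {x : ℂ} (hx : ‖x‖ = 1) {ι : Type*} {l : Filter ι}
    {b : ι → ℕ → ℂ} {c : ℕ → ℂ} (hb : ∀ᶠ i in l, Summable fun n ↦ x ^ n * b i n)
    (hbc : ∀ n, Tendsto (fun i ↦ b i n) l (𝓝 (c n)))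
    (hbound : ∀ᶠ i in l, ∀ n : ℕ, ‖b i (n + 1) - b i n‖ ≤ 2 / ((n : ℝ) + 1) ^ 2) :
    Tendsto (fun i ↦ (1 - x) * ∑' n, x ^ n * b i n) l
      (𝓝 (c 0 + ∑' n, x ^ (n + 1) * (c (n + 1) - c n))) := by
  have hsum : Summable fun n : ℕ ↦ 2 / ((n : ℝ) + 1) ^ 2 := by
    have := ((summable_nat_add_iff 1).mpr (Real.summable_one_div_nat_pow.mpr one_lt_two)).mul_left 2
    refine this.congr fun n ↦ ?_
    push_cast
    ring
  have h1 : Tendsto (fun i ↦ b i 0 + ∑' n, x ^ (n + 1) * (b i (n + 1) - b i n)) l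
      (𝓝 (c 0 + ∑' n, x ^ (n + 1) * (c (n + 1) - c n))) := by
    refine (hbc 0).add (tendsto_tsum_of_dominated_convergence hsum
      (fun n ↦ ((hbc (n + 1)).sub (hbc n)).const_mul _) ?_)
    filter_upwards [hbound] with i hi n
    rw [norm_mul, norm_pow, hx, one_pow, one_mul]
    exact hi n
  refine h1.congr' ?_
  filter_upwards [hb] with i hi
  exact (one_sub_mul_tsum hi).symm

theorem norm_rpow_neg_sub_le {s : ℝ} (h1 : 1 < s) (h2 : s < 2) (n : ℕ) :
    ‖(((n + 1 : ℕ) : ℂ) + 1) ^ (-(s : ℂ)) - ((n : ℂ) + 1) ^ (-(s : ℂ))‖ ≤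
      2 / ((n : ℝ) + 1) ^ 2 := by
  have e : ∀ m : ℕ, ((m : ℂ) + 1) ^ (-(s : ℂ)) = (((m : ℝ) + 1) ^ (-s) : ℝ) := fun m ↦ by
    rw [Complex.ofReal_cpow (by positivity)]
    push_cast
    rfl
  rw [e, e, ← Complex.ofReal_sub, Complex.norm_real, Real.norm_eq_abs, abs_sub_comm]
  set y : ℝ := (n : ℝ) + 1 with hy
  have hy1 : 1 ≤ y := by simp [hy]
  have hy0 : 0 < y := by linarith
  have hcast : (((n + 1 : ℕ) : ℝ) + 1) = y + 1 := by push_cast; ring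
  rw [hcast]
  have hle : (y + 1) ^ (-s) ≤ y ^ (-s) :=
    Real.rpow_le_rpow_of_nonpos hy0 (by linarith) (by linarith)
  rw [abs_of_nonneg (by linarith)]
  have hu0 : 0 < y / (y + 1) := by positivity
  have hu1 : y / (y + 1) ≤ 1 := (div_le_one (by positivity)).mpr (by linarith)
  have e2 : (y + 1) ^ (-s) = y ^ (-s) * (y / (y + 1)) ^ s := by
    rw [Real.div_rpow hy0.le (by positivity), Real.rpow_neg hy0.le, Real.rpow_neg (by positivity)]
    have := (Real.rpow_pos_of_pos hy0 s).ne'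
    field_simp
  have h3 : (y / (y + 1)) ^ (2 : ℝ) ≤ (y / (y + 1)) ^ s :=
    Real.rpow_le_rpow_of_exponent_ge hu0 hu1 h2.le
  have h4 : y ^ (-s) ≤ y ^ (-1 : ℝ) := Real.rpow_le_rpow_of_exponent_le hy1 (by linarith)
  have h5 : 0 ≤ y ^ (-s) := by positivity
  rw [Real.rpow_two] at h3
  rw [Real.rpow_neg_one] at h4
  have h6 : 1 - (y / (y + 1)) ^ 2 ≤ 2 / y := by
    rw [div_pow, sub_le_iff_le_add, div_add_div _ _ (by positivity) (by positivity),
      le_div_iff₀ (by positivity)]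
    nlinarith [hy0, sq_nonneg y]
  calc y ^ (-s) - (y + 1) ^ (-s) = y ^ (-s) * (1 - (y / (y + 1)) ^ s) := by rw [e2]; ring
    _ ≤ y ^ (-s) * (1 - (y / (y + 1)) ^ 2) := by gcongr
    _ ≤ y⁻¹ * (2 / y) := mul_le_mul h4 h6 (sub_nonneg.mpr (pow_le_one₀ hu0.le hu1)) (by positivity)
    _ = 2 / y ^ 2 := by field_simp

theorem norm_pow_div_sub_le {r : ℝ} (h0 : 0 < r) (h1 : r < 1) (n : ℕ) :
    ‖(r : ℂ) ^ (n + 1) / (((n + 1 : ℕ) : ℂ) + 1) - (r : ℂ) ^ n / ((n : ℂ) + 1)‖ ≤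
      2 / ((n : ℝ) + 1) ^ 2 := by
  have e : (r : ℂ) ^ (n + 1) / (((n + 1 : ℕ) : ℂ) + 1) - (r : ℂ) ^ n / ((n : ℂ) + 1) =
      ((r ^ (n + 1) / (((n + 1 : ℕ) : ℝ) + 1) - r ^ n / ((n : ℝ) + 1) : ℝ) : ℂ) := by push_cast; rfl
  rw [e, Complex.norm_real, Real.norm_eq_abs, abs_sub_comm]
  have hgeo : ((n : ℝ) + 1) * (r ^ n * (1 - r)) ≤ 1 := by
    have h2 : ∀ m ∈ Finset.range (n + 1), r ^ n ≤ r ^ m := fun m hm ↦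
      pow_le_pow_of_le_one h0.le h1.le (by simpa [Nat.lt_succ_iff] using hm)
    have h3 := Finset.sum_le_sum h2
    rw [Finset.sum_const, Finset.card_range, nsmul_eq_mul] at h3
    have h4 : (∑ m ∈ Finset.range (n + 1), r ^ m) * (1 - r) = 1 - r ^ (n + 1) := by
      have := geom_sum_mul r (n + 1)
      linarith
    have h5 : 0 < r ^ (n + 1) := by positivity
    push_cast at h3
    nlinarith
  set y : ℝ := (n : ℝ) + 1 with hy
  have hy1 : 1 ≤ y := by simp [hy]
  have hy0 : 0 < y := by linarith
  have hcast : (((n + 1 : ℕ) : ℝ) + 1) = y + 1 := by push_cast; ring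
  rw [hcast]
  have hr1 : r ^ n ≤ 1 := pow_le_one₀ h0.le h1.le
  have hr0 : 0 < r ^ n := by positivity
  have e2 : r ^ n / y - r ^ (n + 1) / (y + 1) =
      (r ^ n + y * (r ^ n * (1 - r))) / (y * (y + 1)) := by
    field_simp
    ring
  rw [e2, abs_of_nonneg (by have : 0 ≤ 1 - r := by linarith
                            positivity), div_le_div_iff₀ (by positivity) (by positivity)]
  nlinarith

theorem expZeta_one {a : ℝ} (ha : (a : UnitAddCircle) ≠ 0) :
    HurwitzZeta.expZeta a 1 = -Complex.log (1 - Complex.exp (2 * Real.pi * Complex.I * a)) := by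
  set x := Complex.exp (2 * Real.pi * Complex.I * a) with hxdef
  have hx : ‖x‖ = 1 := by
    rw [hxdef, show (2 * Real.pi * Complex.I * a : ℂ) = ((2 * Real.pi * a : ℝ) : ℂ) * Complex.I by
      push_cast; ring, Complex.norm_exp_ofReal_mul_I]
  have hx1 : x ≠ 1 := fun h ↦ by
    obtain ⟨n, hn⟩ := Complex.exp_eq_one_iff.mp h
    have h2 : (2 * Real.pi * Complex.I : ℂ) ≠ 0 := Complex.two_pi_I_ne_zero
    have h3 : (a : ℂ) = n := mul_left_cancel₀ h2 (by rw [hn]; ring)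
    have h4 : a = (n : ℝ) := by exact_mod_cast h3
    exact ha (by rw [h4]; exact (AddCircle.coe_eq_zero_iff _).mpr ⟨n, by simp⟩)
  have hx0 : 1 - x ≠ 0 := sub_ne_zero.mpr hx1.symm
  have hre : 0 < (1 - x).re := by
    have h1 : x.re ≤ 1 := hx ▸ Complex.re_le_norm x
    rcases h1.lt_or_eq with h | h
    · simpa using h
    · have h2 := Complex.sq_norm_sub_sq_re x
      rw [hx, h] at h2
      have h3 : x.im = 0 := by nlinarith
      exact absurd (Complex.ext h h3) hx1
  have hcoeff : ∀ n : ℕ, ((n : ℂ) + 1) ≠ 0 := fun n ↦ Nat.cast_add_one_ne_zero n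
  have hlim1 : Tendsto (fun s : ℝ ↦ (1 - x) * ∑' n : ℕ, x ^ n * ((n : ℂ) + 1) ^ (-(s : ℂ)))
      (𝓝[>] 1) (𝓝 (((0 : ℕ) + 1 : ℂ)⁻¹ +
        ∑' n : ℕ, x ^ (n + 1) * ((((n + 1 : ℕ) : ℂ) + 1)⁻¹ - ((n : ℂ) + 1)⁻¹))) := by
    refine tendsto_one_sub_mul_tsum (c := fun n : ℕ ↦ ((n : ℂ) + 1)⁻¹) hx ?_ (fun n ↦ ?_) ?_
    · filter_upwards [self_mem_nhdsWithin] with s hs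
      have h1 := (summable_nat_add_iff 1).mpr
        (Complex.summable_one_div_nat_cpow (p := s).mpr (by simpa using hs))
      refine Summable.of_norm (h1.norm.congr fun n ↦ ?_)
      rw [norm_mul, norm_pow, hx, one_pow, one_mul, Complex.cpow_neg, one_div]
      push_cast
      rfl
    · have hc : Continuous fun s : ℝ ↦ ((n : ℂ) + 1) ^ (-(s : ℂ)) :=
        Continuous.const_cpow (by fun_prop) (.inl (hcoeff n))
      refine (hc.tendsto' 1 _ ?_).mono_left nhdsWithin_le_nhds
      rw [Complex.ofReal_one, Complex.cpow_neg_one]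
    · filter_upwards [Ioo_mem_nhdsGT (show (1 : ℝ) < 2 by norm_num)] with s hs n
      exact norm_rpow_neg_sub_le hs.1 hs.2 n
  have hlim2 : Tendsto (fun r : ℝ ↦ (1 - x) * ∑' n : ℕ, x ^ n * ((r : ℂ) ^ n / ((n : ℂ) + 1)))
      (𝓝[<] 1) (𝓝 (((0 : ℕ) + 1 : ℂ)⁻¹ +
        ∑' n : ℕ, x ^ (n + 1) * ((((n + 1 : ℕ) : ℂ) + 1)⁻¹ - ((n : ℂ) + 1)⁻¹))) := by
    refine tendsto_one_sub_mul_tsum (c := fun n : ℕ ↦ ((n : ℂ) + 1)⁻¹) hx ?_ (fun n ↦ ?_) ?_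
    · filter_upwards [Ioo_mem_nhdsLT (show (0 : ℝ) < 1 by norm_num)] with r hr
      refine Summable.of_norm_bounded (summable_geometric_of_lt_one hr.1.le hr.2) fun n ↦ ?_
      have h2 : (1 : ℝ) ≤ n + 1 := by simp
      have h3 : ‖(n : ℂ) + 1‖ = (n : ℝ) + 1 := by
        rw [← Nat.cast_add_one, Complex.norm_natCast, Nat.cast_add_one]
      rw [norm_mul, norm_pow, hx, one_pow, one_mul, norm_div, norm_pow, Complex.norm_real, h3,
        Real.norm_eq_abs, abs_of_pos hr.1]
      exact div_le_self (pow_nonneg hr.1.le n) h2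
    · have hc : Continuous fun r : ℝ ↦ (r : ℂ) ^ n / ((n : ℂ) + 1) := by fun_prop
      refine (hc.tendsto' 1 _ ?_).mono_left nhdsWithin_le_nhds
      rw [Complex.ofReal_one, one_pow, one_div]
    · filter_upwards [Ioo_mem_nhdsLT (show (0 : ℝ) < 1 by norm_num)] with r hr n
      exact norm_pow_div_sub_le hr.1 hr.2 n
  have hval1 : Tendsto (fun s : ℝ ↦ (1 - x) * ∑' n : ℕ, x ^ n * ((n : ℂ) + 1) ^ (-(s : ℂ)))
      (𝓝[>] 1) (𝓝 ((1 - x) * (x⁻¹ * HurwitzZeta.expZeta a 1))) := by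
    have hc : Continuous fun s : ℝ ↦ (1 - x) * (x⁻¹ * HurwitzZeta.expZeta a (s : ℂ)) := by
      have := (HurwitzZeta.differentiable_expZeta_of_ne_zero ha).continuous
      fun_prop
    refine ((hc.tendsto' 1 _ (by simp)).mono_left nhdsWithin_le_nhds).congr' ?_
    filter_upwards [self_mem_nhdsWithin] with s hs
    have hs0 : (s : ℂ) ≠ 0 := by
      exact_mod_cast (zero_lt_one.trans hs).ne'
    have h := HurwitzZeta.hasSum_expZeta_of_one_lt_re a (s := s) (by simpa using hs)
    rw [← h.tsum_eq, h.summable.tsum_eq_zero_add, Nat.cast_zero,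
      Complex.zero_cpow hs0, div_zero, zero_add, ← tsum_mul_left]
    congr 1
    refine tsum_congr fun n ↦ ?_
    have hexp : Complex.exp (2 * Real.pi * Complex.I * a * ((n + 1 : ℕ) : ℂ)) = x ^ (n + 1) := by
      rw [hxdef, ← Complex.exp_nat_mul]
      ring_nf
    rw [hexp, Complex.cpow_neg, Nat.cast_add_one, pow_succ]
    have hxne : x ≠ 0 := Complex.exp_ne_zero _
    field_simp
  have hval2 : Tendsto (fun r : ℝ ↦ (1 - x) * ∑' n : ℕ, x ^ n * ((r : ℂ) ^ n / ((n : ℂ) + 1)))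
      (𝓝[<] 1) (𝓝 ((1 - x) * (x⁻¹ * -Complex.log (1 - x)))) := by
    have hc : Tendsto (fun r : ℝ ↦ (1 - x) * ((r * x)⁻¹ * -Complex.log (1 - r * x))) (𝓝 1)
        (𝓝 ((1 - x) * (x⁻¹ * -Complex.log (1 - x)))) := by
      have hxne : x ≠ 0 := Complex.exp_ne_zero _
      have h1 : ContinuousAt (fun r : ℝ ↦ (r : ℂ) * x) 1 := by fun_prop
      have h2 : ContinuousAt (fun r : ℝ ↦ (1 - x) * ((r * x)⁻¹ * -Complex.log (1 - r * x))) 1 := by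
        refine continuousAt_const.mul ((h1.inv₀ (by simpa using hxne)).mul
          (ContinuousAt.clog (continuousAt_const.sub h1) ?_).neg)
        change (1 : ℂ) - ((1 : ℝ) : ℂ) * x ∈ Complex.slitPlane
        rw [Complex.ofReal_one, one_mul]
        exact .inl hre
      simpa [ContinuousAt] using h2
    refine (hc.mono_left nhdsWithin_le_nhds).congr' ?_
    filter_upwards [Ioo_mem_nhdsLT (show (0 : ℝ) < 1 by norm_num)] with r hr
    have hxr : (r : ℂ) * x ≠ 0 := mul_ne_zero (by exact_mod_cast hr.1.ne') (Complex.exp_ne_zero _)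
    have h := Complex.hasSum_taylorSeries_neg_log (z := r * x) (by
      rw [norm_mul, hx, mul_one, Complex.norm_real, Real.norm_eq_abs, abs_of_pos hr.1]
      exact hr.2)
    rw [← h.tsum_eq, h.summable.tsum_eq_zero_add, Nat.cast_zero, div_zero, zero_add,
      ← tsum_mul_left]
    congr 1
    refine tsum_congr fun n ↦ ?_
    rw [pow_succ, mul_comm (((r : ℂ) * x) ^ n), mul_div_assoc, inv_mul_cancel_left₀ hxr, mul_pow,
      Nat.cast_add_one]
    ring
  have h1 := tendsto_nhds_unique hval1 hlim1
  have h2 := tendsto_nhds_unique hval2 hlim2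
  exact mul_left_cancel₀ (inv_ne_zero (Complex.exp_ne_zero _))
    (mul_left_cancel₀ hx0 (h1.trans h2.symm))

end ExpZetaOne

section LValue

open Filter Topology

open ZMod Complex

theorem log_one_sub_exp {t : ℝ} (h0 : 0 < t) (h1 : t < 1) :
    Complex.log (1 - Complex.exp (2 * Real.pi * I * t)) =
      (Real.log ‖1 - Complex.exp (2 * Real.pi * I * t)‖ : ℝ) +
        (Real.pi * (t - 1 / 2) : ℝ) * I := by
  have hpi := Real.pi_pos
  have hs : 0 < 2 * Real.sin (Real.pi * t) := by
    have := Real.sin_pos_of_pos_of_lt_pi (x := Real.pi * t) (by positivity) (by nlinarith)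
    positivity
  have h2 : 1 - Complex.exp (2 * Real.pi * I * t) =
      ((2 * Real.sin (Real.pi * t) : ℝ) : ℂ) * Complex.exp ((Real.pi * (t - 1 / 2) : ℝ) * I) := by
    have e1 : Complex.exp ((Real.pi * (t - 1 / 2) : ℝ) * I) =
        Complex.exp ((Real.pi * t : ℝ) * I) * (-I) := by
      rw [show ((Real.pi * (t - 1 / 2) : ℝ) : ℂ) * I =
        (Real.pi * t : ℝ) * I - Real.pi / 2 * I by push_cast; ring, Complex.exp_sub,
        Complex.exp_pi_div_two_mul_I, Complex.div_I]
      ring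
    have e2 : Complex.exp (2 * Real.pi * I * t) =
        Complex.exp ((Real.pi * t : ℝ) * I) * Complex.exp ((Real.pi * t : ℝ) * I) := by
      rw [← Complex.exp_add]
      congr 1
      push_cast
      ring
    have e3 : Complex.exp (-(Real.pi * t : ℝ) * I) * Complex.exp ((Real.pi * t : ℝ) * I) = 1 := by
      rw [← Complex.exp_add, neg_mul, neg_add_cancel, Complex.exp_zero]
    rw [e1, e2]
    push_cast [Complex.sin] at e3 ⊢
    linear_combination (Complex.exp (-(↑Real.pi * ↑t) * I) * Complex.exp (↑Real.pi * ↑t * I) -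
      Complex.exp (↑Real.pi * ↑t * I) ^ 2) * Complex.I_sq - e3
  have h3 : ‖1 - Complex.exp (2 * Real.pi * I * t)‖ = 2 * Real.sin (Real.pi * t) := by
    rw [h2, norm_mul, Complex.norm_exp_ofReal_mul_I, mul_one, Complex.norm_real,
      Real.norm_of_nonneg hs.le]
  rw [h3, h2, Complex.log_ofReal_mul hs (Complex.exp_ne_zero _), Complex.log_exp]
  · simp only [mul_im, ofReal_re, I_im, ofReal_im, I_re]
    nlinarith
  · simp only [mul_im, ofReal_re, I_im, ofReal_im, I_re]
    nlinarith

theorem DirichletCharacter.inv_apply_neg_one {N : ℕ} (χ : DirichletCharacter ℂ N) :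
    χ⁻¹ (-1) = χ (-1) := by
  have h3 : χ⁻¹ (-1) * χ (-1) = 1 := by
    rw [← MulChar.mul_apply, inv_mul_cancel, MulChar.one_apply isUnit_one.neg]
  have h6 : χ (-1) * χ (-1) = 1 := by
    rw [← map_mul, neg_mul_neg, one_mul, map_one]
  linear_combination χ (-1) * h3 - χ⁻¹ (-1) * h6

variable {N : ℕ} [NeZero N]

theorem ZMod.LFunction_const_mul (c : ℂ) (Φ : ZMod N → ℂ) (s : ℂ) :
    ZMod.LFunction (fun j ↦ c * Φ j) s = c * ZMod.LFunction Φ s := by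
  simp only [ZMod.LFunction, Finset.mul_sum]
  exact Finset.sum_congr rfl fun _ _ ↦ by ring

theorem DirichletCharacter.norm_gaussSum_sq {χ : DirichletCharacter ℂ N} (hχ : χ.IsPrimitive) :
    ‖gaussSum χ stdAddChar‖ ^ 2 = N := by
  have hinv : χ⁻¹.IsPrimitive := by
    rw [DirichletCharacter.isPrimitive_def, DirichletCharacter.conductor_inv]
    exact hχ
  have h1 : gaussSum χ stdAddChar * gaussSum χ⁻¹ stdAddChar = N * χ (-1) := by
    have h := congrFun (ZMod.dft_dft (χ : ZMod N → ℂ)) 1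
    have h2 : ZMod.dft (χ : ZMod N → ℂ) =
        fun k ↦ χ⁻¹ (-1) * gaussSum χ stdAddChar * χ⁻¹ k := by
      ext k
      rw [hχ.fourierTransform_eq_inv_mul_gaussSum, ← neg_one_mul k, map_mul]
      ring
    simp only [h2, ZMod.dft_const_mul] at h
    rw [hinv.fourierTransform_eq_inv_mul_gaussSum, inv_inv, smul_eq_mul] at h
    have h3 : χ⁻¹ (-1) * χ (-1) = 1 := by
      rw [← MulChar.mul_apply, inv_mul_cancel, MulChar.one_apply isUnit_one.neg]
    linear_combination h - gaussSum χ stdAddChar * gaussSum χ⁻¹ stdAddChar * h3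
  have h4 : star (gaussSum χ stdAddChar) = χ (-1) * gaussSum χ⁻¹ stdAddChar := by
    rw [star_gaussSum_eq, gaussSum, gaussSum, Finset.mul_sum, ← Equiv.sum_comp (Equiv.neg _)]
    refine Finset.sum_congr rfl fun j _ ↦ ?_
    have h5 : χ⁻¹ (-1) = χ (-1) := by
      exact χ.inv_apply_neg_one
    rw [Equiv.neg_apply, AddChar.inv_apply, neg_neg, ← neg_one_mul, map_mul, h5, mul_assoc]
  have h6 : χ (-1) * χ (-1) = 1 := by
    rw [← map_mul, neg_mul_neg, one_mul, map_one]
  have h7 : gaussSum χ stdAddChar * star (gaussSum χ stdAddChar) = N := by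
    rw [h4]
    linear_combination χ (-1) * h1 + N * h6
  rw [← Complex.normSq_eq_norm_sq]
  exact_mod_cast (Complex.mul_conj _).symm.trans h7

theorem DirichletCharacter.gaussSum_mul_LFunction_one {χ : DirichletCharacter ℂ N}
    (hN : 1 < N) (hχ : χ.IsPrimitive) :
    χ (-1) * gaussSum χ stdAddChar * χ⁻¹.LFunction 1 =
      -∑ j : ZMod N, χ (-j) * ((Real.log ‖1 - Complex.exp (2 * Real.pi * I * (j.val / N : ℝ))‖ : ℝ)
         + (Real.pi * (j.val / N - 1 / 2) : ℝ) * I) := by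
  have h0 : χ 0 = 0 := χ.map_zero' hN.ne'
  have h1 := ZMod.LFunction_dft (χ : ZMod N → ℂ) (s := 1) (Or.inl h0)
  have h2 : ZMod.dft (χ : ZMod N → ℂ) =
      fun k ↦ χ⁻¹ (-1) * gaussSum χ stdAddChar * χ⁻¹ k := by
    ext k
    rw [hχ.fourierTransform_eq_inv_mul_gaussSum, ← neg_one_mul k, map_mul]
    ring
  have h5 : χ⁻¹ (-1) = χ (-1) := by
    exact χ.inv_apply_neg_one
  rw [h2, ZMod.LFunction_const_mul, h5] at h1
  rw [DirichletCharacter.LFunction, h1, ← Equiv.sum_comp (Equiv.neg _), ← Finset.sum_neg_distrib]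
  refine Finset.sum_congr rfl fun j _ ↦ ?_
  rw [Equiv.neg_apply, neg_neg]
  by_cases hj : j = 0
  · simp [hj, h0]
  have hN' : (0 : ℝ) < N := by exact_mod_cast hN.pos
  have hv : 0 < j.val := by
    rw [Nat.pos_iff_ne_zero, Ne, ZMod.val_eq_zero]
    exact hj
  have hlt : j.val < N := ZMod.val_lt j
  rw [ZMod.toAddCircle_apply, expZeta_one, ← mul_neg, log_one_sub_exp (by positivity)
    (by rw [div_lt_one hN']; exact_mod_cast hlt)]
  rw [← ZMod.toAddCircle_apply, Ne, ZMod.toAddCircle_eq_zero]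
  exact hj

theorem ZMod.val_neg_eq_sub {j : ZMod N} (hj : j ≠ 0) : ((-j).val : ℂ) = N - j.val := by
  have : NeZero j := ⟨hj⟩
  rw [ZMod.val_neg_of_ne_zero, Nat.cast_sub (ZMod.val_lt j).le]

theorem ZMod.norm_one_sub_exp_neg (j : ZMod N) :
    ‖1 - Complex.exp (2 * Real.pi * I * ((-j).val / N : ℝ))‖ =
      ‖1 - Complex.exp (2 * Real.pi * I * (j.val / N : ℝ))‖ := by
  by_cases hj : j = 0
  · rw [hj, neg_zero]
  have hN : (N : ℂ) ≠ 0 := NeZero.ne _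
  rw [← Complex.norm_conj (1 - Complex.exp (2 * Real.pi * I * (j.val / N : ℝ))), map_sub,
    ← Complex.exp_conj, map_one]
  congr 2
  rw [Complex.exp_eq_exp_iff_exists_int]
  refine ⟨1, ?_⟩
  simp only [map_mul, Complex.conj_I, Complex.conj_ofReal, map_ofNat]
  push_cast
  rw [ZMod.val_neg_eq_sub hj]
  field_simp
  ring

theorem DirichletCharacter.norm_gaussSum_mul_LFunction_inv_one {χ : DirichletCharacter ℂ N}
    (hN : 1 < N) (hχ : χ.IsPrimitive) :
    √N * ‖χ⁻¹.LFunction 1‖ =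
      ‖∑ j : ZMod N, χ j * ((Real.log ‖1 - Complex.exp (2 * Real.pi * I * (j.val / N : ℝ))‖ : ℝ)
         + (Real.pi * (j.val / N - 1 / 2) : ℝ) * I)‖ := by
  have hτ : ‖gaussSum χ stdAddChar‖ = √N := by
    rw [← DirichletCharacter.norm_gaussSum_sq hχ, Real.sqrt_sq (norm_nonneg _)]
  have hneg : ‖χ (-1)‖ = 1 := by
    have := χ.unit_norm_eq_one (-1)
    simpa using this
  have h := congrArg norm (DirichletCharacter.gaussSum_mul_LFunction_one hN hχ)
  have hj (j : ZMod N) : χ (-j) = χ (-1) * χ j := by rw [← map_mul, neg_one_mul]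
  generalize χ (-1) = c at hj h hneg
  simp_rw [hj, mul_assoc, ← Finset.mul_sum] at h
  rw [norm_mul, norm_mul, hτ, hneg, one_mul, norm_neg, norm_mul, hneg, one_mul] at h
  simpa only [mul_assoc] using h

theorem DirichletCharacter.norm_LFunction_inv_one_of_even {χ : DirichletCharacter ℂ N}
    (hN : 1 < N) (hχ : χ.IsPrimitive) (he : χ.Even) :
    √N * ‖χ⁻¹.LFunction 1‖ =
      ‖∑ j : ZMod N, χ j *
        (Real.log ‖1 - Complex.exp (2 * Real.pi * I * (j.val / N : ℝ))‖ : ℝ)‖ := by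
  have hN0 : (N : ℂ) ≠ 0 := NeZero.ne _
  have h0 : ∑ j : ZMod N, χ j * ((Real.pi * (j.val / N - 1 / 2) : ℝ) * I) = 0 := by
    rw [← self_eq_neg, ← Finset.sum_neg_distrib]
    refine Fintype.sum_equiv (Equiv.neg _) _ _ fun j ↦ ?_
    rw [Equiv.neg_apply, he.eval_neg]
    by_cases hj : j = 0
    · simp [hj, χ.map_zero' hN.ne']
    push_cast
    rw [ZMod.val_neg_eq_sub hj]
    field_simp
    ring
  rw [DirichletCharacter.norm_gaussSum_mul_LFunction_inv_one hN hχ]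
  simp_rw [mul_add]
  rw [Finset.sum_add_distrib, h0, add_zero]

theorem DirichletCharacter.norm_LFunction_inv_one_of_odd {χ : DirichletCharacter ℂ N}
    (hN : 1 < N) (hχ : χ.IsPrimitive) (ho : χ.Odd) :
    N * √N * ‖χ⁻¹.LFunction 1‖ = Real.pi * ‖∑ j : ZMod N, χ j * (j.val : ℂ)‖ := by
  have hN0 : (N : ℂ) ≠ 0 := NeZero.ne _
  have h0 : ∑ j : ZMod N, χ j *
      (Real.log ‖1 - Complex.exp (2 * Real.pi * I * (j.val / N : ℝ))‖ : ℝ) = 0 := by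
    rw [← self_eq_neg, ← Finset.sum_neg_distrib]
    refine Fintype.sum_equiv (Equiv.neg _) _ _ fun j ↦ ?_
    rw [Equiv.neg_apply, ho.eval_neg, ZMod.norm_one_sub_exp_neg]
    ring
  have hne : χ ≠ 1 := by
    rintro rfl
    have := ho.symm.trans (MulChar.one_apply isUnit_one.neg)
    norm_num at this
  have h1 : ∑ j : ZMod N, χ j * ((Real.pi * (j.val / N - 1 / 2) : ℝ) * I) =
      (Real.pi / N * I) * ∑ j : ZMod N, χ j * (j.val : ℂ) := by
    have h2 := MulChar.sum_eq_zero_of_ne_one hne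
    have h3 : ∀ j : ZMod N, χ j * ((Real.pi * (j.val / N - 1 / 2) : ℝ) * I) =
        (Real.pi / N * I) * (χ j * (j.val : ℂ)) - (Real.pi / 2 * I) * χ j := by
      intro j
      push_cast
      ring
    simp_rw [h3]
    rw [Finset.sum_sub_distrib, ← Finset.mul_sum, ← Finset.mul_sum, h2, mul_zero, sub_zero]
  rw [mul_assoc, DirichletCharacter.norm_gaussSum_mul_LFunction_inv_one hN hχ]
  simp_rw [mul_add]
  rw [Finset.sum_add_distrib, h0, zero_add, h1, norm_mul, norm_mul, norm_div, Complex.norm_I,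
    Complex.norm_real, Complex.norm_natCast, Real.norm_of_nonneg Real.pi_pos.le]
  have : (N : ℝ) ≠ 0 := NeZero.ne _
  field_simp
end LValue

section ResidueLogs

open IsDedekindDomain NumberField Filter Topology

open DirichletCharacter

/-- The real number `log |1 - exp (2 π i a / N)|`. -/
noncomputable def logOneSub (N a : ℕ) : ℝ :=
  Real.log ‖1 - Complex.exp (2 * Real.pi * Complex.I * (a / N : ℝ))‖

theorem logOneSub_add_mul (N a m : ℕ) [NeZero N] : logOneSub N (a + N * m) = logOneSub N a := by
  have hN : (N : ℂ) ≠ 0 := NeZero.ne _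
  rw [logOneSub, logOneSub]
  congr 3
  rw [Complex.exp_eq_exp_iff_exists_int]
  refine ⟨m, ?_⟩
  push_cast
  field_simp

theorem logOneSub_mod (N a : ℕ) [NeZero N] : logOneSub N (a % N) = logOneSub N a := by
  conv_rhs => rw [← Nat.mod_add_div a N, logOneSub_add_mul]

theorem logOneSub_congr {N a b : ℕ} [NeZero N] (h : a ≡ b [MOD N]) :
    logOneSub N a = logOneSub N b := by
  rw [← logOneSub_mod, h, logOneSub_mod]

theorem logOneSub_val_neg {N : ℕ} [NeZero N] (j : ZMod N) :
    logOneSub N (-j).val = logOneSub N j.val := by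
  rw [logOneSub, logOneSub, ZMod.norm_one_sub_exp_neg]

/-! ### Sums over residue classes in terms of powers of a generator -/

theorem sum_dirichletCharacter_nineteen (β : DirichletCharacter ℂ 19) (f : ZMod 19 → ℂ) :
    ∑ j, β j * f j = ∑ k ∈ Finset.range 18, β 2 ^ k * f (2 ^ k) := by
  have h : (Finset.univ : Finset (ZMod 19)) =
      insert 0 ((Finset.range 18).image fun k ↦ 2 ^ k) := by decide
  rw [h, Finset.sum_insert (by decide), Finset.sum_image (by decide),
    β.map_nonunit not_isUnit_zero, zero_mul, zero_add]
  simp only [map_pow]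

theorem sum_dirichletCharacter_57 (χ : DirichletCharacter ℂ 57) (f : ZMod 57 → ℂ) :
    ∑ j, χ j * f j =
      ∑ k ∈ Finset.range 18, χ 40 ^ k * (f (40 ^ k) + χ (-1) * f (-40 ^ k)) := by
  have h : (Finset.univ.filter fun j : ZMod 57 ↦ j.val.Coprime 57) =
      ((Finset.range 18).image fun k ↦ 40 ^ k) ∪ ((Finset.range 18).image fun k ↦ -40 ^ k) := by
    decide +kernel
  have hd : Disjoint ((Finset.range 18).image fun k ↦ (40 : ZMod 57) ^ k)
      ((Finset.range 18).image fun k ↦ -(40 : ZMod 57) ^ k) := by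
    decide +kernel
  have h0 : ∑ j, χ j * f j =
      ∑ j ∈ (Finset.univ.filter fun j : ZMod 57 ↦ j.val.Coprime 57), χ j * f j := by
    rw [Finset.sum_filter]
    refine Finset.sum_congr rfl fun j _ ↦ ?_
    split_ifs with hj
    · rfl
    · rw [χ.map_nonunit, zero_mul]
      rwa [← ZMod.natCast_zmod_val j, ZMod.isUnit_iff_coprime]
  rw [h0, h, Finset.sum_union hd, Finset.sum_image (by decide +kernel),
    Finset.sum_image (by decide +kernel), ← Finset.sum_add_distrib]
  refine Finset.sum_congr rfl fun k _ ↦ ?_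
  rw [← neg_one_mul, map_mul, map_pow]
  ring

theorem isPrimitive_of_prime {p : ℕ} [hp : Fact p.Prime] {χ : DirichletCharacter ℂ p}
    (hχ : χ ≠ 1) : χ.IsPrimitive := by
  rw [isPrimitive_def]
  refine ((Nat.dvd_prime hp.out).mp χ.conductor_dvd_level).resolve_left fun h ↦ hχ ?_
  exact χ.eq_one_iff_conductor_eq_one.mpr h

theorem char57_forty (β : DirichletCharacter ℂ 19) : char57 chi3 β 40 = β 2 := by
  have := char57_apply_of_coprime chi3 β (a := 40) (by norm_num)
  have h1 : ((40 : ℕ) : ZMod 3) = 1 := by decide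
  have h2 : ((40 : ℕ) : ZMod 19) = 2 := by decide
  rw [h1, h2, map_one, one_mul] at this
  exact_mod_cast this

theorem char57_twenty (β : DirichletCharacter ℂ 19) : char57 chi3 β 20 = -1 := by
  have := char57_apply_of_coprime chi3 β (a := 20) (by norm_num)
  have h1 : ((20 : ℕ) : ZMod 3) = 2 := by decide
  have h2 : ((20 : ℕ) : ZMod 19) = 1 := by decide
  rw [h1, h2, map_one, mul_one, chi3_two] at this
  exact_mod_cast this

theorem apply_neg_one_nineteen (β : DirichletCharacter ℂ 19) : β (-1) = β 2 ^ 9 := by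
  rw [← map_pow]
  congr 1

theorem char57_neg_one (β : DirichletCharacter ℂ 19) : char57 chi3 β (-1) = -β 2 ^ 9 := by
  have := char57_apply_of_coprime chi3 β (a := 56) (by norm_num)
  have h1 : ((56 : ℕ) : ZMod 3) = -1 := by decide
  have h2 : ((56 : ℕ) : ZMod 19) = -1 := by decide
  have h3 : ((56 : ℕ) : ZMod 57) = -1 := by decide
  rw [h1, h2, h3, chi3_neg_one, apply_neg_one_nineteen] at this
  rw [this, neg_one_mul]

theorem isPrimitive_char57 {β : DirichletCharacter ℂ 19} (hβ : β ≠ 1) :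
    (char57 chi3 β).IsPrimitive := by
  have hβ2 : β 2 ≠ 1 := fun h ↦ hβ (dirichletCharacter_nineteen_ext
    (h.trans (MulChar.one_apply (by decide)).symm))
  set χ := char57 chi3 β with hχ
  have key : ∀ d a : ℕ, (hd : d ∣ 57) → (ha : a.Coprime 57) → (a : ZMod d) = 1 →
      χ (a : ZMod 57) ≠ 1 → ¬ χ.conductor ∣ d := by
    intro d a hd ha h1 h2 h3
    have h4 := (χ.mem_conductorSet_iff_conductor_dvd hd).mpr h3
    rw [mem_conductorSet_iff, factorsThrough_iff_ker_unitsMap hd] at h4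
    have h5 : ZMod.unitOfCoprime a ha ∈ (ZMod.unitsMap hd).ker := by
      rw [MonoidHom.mem_ker, Units.ext_iff, ZMod.unitsMap_val, ZMod.coe_unitOfCoprime,
        ZMod.cast_natCast hd, h1, Units.val_one]
    have h6 := MonoidHom.mem_ker.mp (h4 h5)
    rw [Units.ext_iff, MulChar.coe_toUnitHom, ZMod.coe_unitOfCoprime] at h6
    exact h2 h6
  have h3 : ¬ χ.conductor ∣ 3 := key 3 40 (by norm_num) (by norm_num) (by decide) (by
    have := char57_forty β
    rw [← hχ] at this
    push_cast
    rwa [this])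
  have h19 : ¬ χ.conductor ∣ 19 := key 19 20 (by norm_num) (by norm_num) (by decide) (by
    have := char57_twenty β
    rw [← hχ] at this
    push_cast
    rw [this]
    norm_num)
  rw [isPrimitive_def]
  have hmem : χ.conductor ∈ Nat.divisors 57 := Nat.mem_divisors.mpr
    ⟨χ.conductor_dvd_level, by norm_num⟩
  rw [show Nat.divisors 57 = {1, 3, 19, 57} by decide +kernel] at hmem
  simp only [Finset.mem_insert, Finset.mem_singleton] at hmem
  rcases hmem with h | h | h | h
  · exact absurd (h ▸ one_dvd 3) h3
  · exact absurd h.dvd h3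
  · exact absurd h.dvd h19
  · exact h

end ResidueLogs

section ResidueValues

open IsDedekindDomain NumberField Filter Topology

open DirichletCharacter

/-- The twisted sum of logarithms of cyclotomic numbers of level `19`. -/
noncomputable def logSum19 (z : ℂ) : ℂ :=
  ∑ k ∈ Finset.range 18, z ^ k * (logOneSub 19 (2 ^ k) : ℝ)

/-- The twisted sum of logarithms of cyclotomic units of level `57`. -/
noncomputable def logSum57 (z : ℂ) : ℂ :=
  ∑ k ∈ Finset.range 18, z ^ k * (2 * logOneSub 57 (40 ^ k) : ℝ)

/-- The generalized Bernoulli sum of level `19`. -/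
noncomputable def bernSum19 (z : ℂ) : ℂ :=
  ∑ k ∈ Finset.range 18, z ^ k * ((2 ^ k % 19 : ℕ) : ℂ)

/-- The generalized Bernoulli sum of level `57`. -/
noncomputable def bernSum57 (z : ℂ) : ℂ :=
  ∑ k ∈ Finset.range 18, z ^ k * (2 * ((40 ^ k % 57 : ℕ) : ℂ) - 57)

theorem norm_LFunction_inv_nineteen_even {β : DirichletCharacter ℂ 19} (hβ : β ≠ 1)
    (h : β 2 ^ 9 = 1) : √19 * ‖β⁻¹.LFunction 1‖ = ‖logSum19 (β 2)‖ := by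
  have := norm_LFunction_inv_one_of_even (by norm_num) (isPrimitive_of_prime hβ)
    (show β.Even from (apply_neg_one_nineteen β).trans h)
  rw [Nat.cast_ofNat] at this
  rw [this, sum_dirichletCharacter_nineteen, logSum19]
  congr 1
  refine Finset.sum_congr rfl fun k _ ↦ ?_
  rw [← logOneSub_mod, logOneSub, ← ZMod.val_natCast]
  push_cast
  rfl

theorem norm_LFunction_inv_nineteen_odd {β : DirichletCharacter ℂ 19}
    (h : β 2 ^ 9 = -1) : 19 * √19 * ‖β⁻¹.LFunction 1‖ = Real.pi * ‖bernSum19 (β 2)‖ := by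
  have hβ : β ≠ 1 := by
    rintro rfl
    rw [MulChar.one_apply (by decide)] at h
    norm_num at h
  have := norm_LFunction_inv_one_of_odd (by norm_num) (isPrimitive_of_prime hβ)
    (show β.Odd from (apply_neg_one_nineteen β).trans h)
  rw [Nat.cast_ofNat] at this
  rw [this, sum_dirichletCharacter_nineteen, bernSum19]
  congr 2

theorem norm_LFunction_inv_57_even {β : DirichletCharacter ℂ 19}
    (h : β 2 ^ 9 = -1) : √57 * ‖(char57 chi3 β)⁻¹.LFunction 1‖ = ‖logSum57 (β 2)‖ := by
  have hβ : β ≠ 1 := by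
    rintro rfl
    rw [MulChar.one_apply (by decide)] at h
    norm_num at h
  have he : (char57 chi3 β) (-1) = 1 := by rw [char57_neg_one, h, neg_neg]
  have := norm_LFunction_inv_one_of_even (by norm_num) (isPrimitive_char57 hβ) he
  rw [Nat.cast_ofNat] at this
  rw [this, sum_dirichletCharacter_57 _ fun j ↦ ((Real.log ‖1 - Complex.exp (2 * Real.pi *
    Complex.I * (j.val / 57 : ℝ))‖ : ℝ) : ℂ), logSum57, he, char57_forty]
  congr 1
  refine Finset.sum_congr rfl fun k _ ↦ ?_
  have h1 := ZMod.norm_one_sub_exp_neg ((40 : ZMod 57) ^ k)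
  rw [Nat.cast_ofNat] at h1
  rw [h1, ← logOneSub_mod, logOneSub, ← ZMod.val_natCast]
  push_cast
  ring

theorem norm_LFunction_inv_57_odd {β : DirichletCharacter ℂ 19} (hβ : β ≠ 1)
    (h : β 2 ^ 9 = 1) :
    57 * √57 * ‖(char57 chi3 β)⁻¹.LFunction 1‖ = Real.pi * ‖bernSum57 (β 2)‖ := by
  have ho : (char57 chi3 β) (-1) = -1 := by rw [char57_neg_one, h]
  have := norm_LFunction_inv_one_of_odd (by norm_num) (isPrimitive_char57 hβ) ho
  rw [Nat.cast_ofNat] at this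
  rw [this, sum_dirichletCharacter_57 _ fun j ↦ (j.val : ℂ), bernSum57, ho, char57_forty]
  congr 2
  refine Finset.sum_congr rfl fun k _ ↦ ?_
  have : Fact (1 < 57) := ⟨by norm_num⟩
  have hne : (40 : ZMod 57) ^ k ≠ 0 :=
    (IsUnit.pow k (by decide +kernel : IsUnit (40 : ZMod 57))).ne_zero
  rw [ZMod.val_neg_eq_sub hne, ← ZMod.val_natCast]
  push_cast
  ring

theorem norm_LFunction_chi3 : 3 * √3 * ‖chi3.LFunction 1‖ = Real.pi := by
  have hi : chi3⁻¹ = chi3 := dirichletCharacter_three_ext (by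
    rw [show (2 : ZMod 3) = -1 by decide, inv_apply_neg_one])
  have := norm_LFunction_inv_one_of_odd (by norm_num) (isPrimitive_of_prime chi3_ne_one)
    (show chi3.Odd from chi3_neg_one)
  rw [Nat.cast_ofNat, hi] at this
  rw [this, show (Finset.univ : Finset (ZMod 3)) = {0, 1, 2} by decide]
  have h2 : (2 : ZMod 3).val = 2 := rfl
  have h1 : (1 : ZMod 3).val = 1 := rfl
  rw [Finset.sum_insert (by decide), Finset.sum_insert (by decide), Finset.sum_singleton,
    ZMod.val_zero, chi3_two, h1, h2, map_one]
  norm_num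

/-- The nontrivial ninth roots of unity in `ℂ`. -/
noncomputable def rootsPlus : Finset ℂ := (Polynomial.nthRootsFinset 9 (1 : ℂ)).erase 1

/-- The ninth roots of `-1` in `ℂ`. -/
noncomputable def rootsMinus : Finset ℂ := Polynomial.nthRootsFinset 9 (-1 : ℂ)

theorem mem_rootsPlus {z : ℂ} : z ∈ rootsPlus ↔ z ≠ 1 ∧ z ^ 9 = 1 := by
  rw [rootsPlus, Finset.mem_erase, Polynomial.mem_nthRootsFinset (by norm_num)]

theorem mem_rootsMinus {z : ℂ} : z ∈ rootsMinus ↔ z ^ 9 = -1 := by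
  rw [rootsMinus, Polynomial.mem_nthRootsFinset (by norm_num)]

theorem disjoint_rootsPlus_rootsMinus : Disjoint rootsPlus rootsMinus := by
  refine Finset.disjoint_left.mpr fun z h1 h2 ↦ ?_
  have h3 := (mem_rootsPlus.mp h1).2.symm.trans (mem_rootsMinus.mp h2)
  norm_num at h3

theorem card_rootsPlus : rootsPlus.card = 8 := by
  have h := (Complex.isPrimitiveRoot_exp 9 (by norm_num)).card_nthRootsFinset
  rw [rootsPlus, Finset.card_erase_of_mem, h]
  rw [Polynomial.mem_nthRootsFinset (by norm_num), one_pow]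

theorem rootsMinus_eq_image : rootsMinus =
    (Polynomial.nthRootsFinset 9 (1 : ℂ)).image fun z ↦ -z := by
  ext z
  rw [mem_rootsMinus, Finset.mem_image]
  refine ⟨fun h ↦ ⟨-z, ?_, neg_neg z⟩, ?_⟩
  · rw [Polynomial.mem_nthRootsFinset (by norm_num), Odd.neg_pow (by decide), h, neg_neg]
  · rintro ⟨y, hy, rfl⟩
    rw [Polynomial.mem_nthRootsFinset (by norm_num)] at hy
    rw [Odd.neg_pow (by decide), hy]

theorem card_rootsMinus : rootsMinus.card = 9 := by
  rw [rootsMinus_eq_image, Finset.card_image_of_injective _ neg_injective,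
    (Complex.isPrimitiveRoot_exp 9 (by norm_num)).card_nthRootsFinset]

open Classical in
theorem prod_dirichletCharacter_nineteen (F : ℂ → ℝ) :
    ∏ β ∈ ({1}ᶜ : Finset (DirichletCharacter ℂ 19)), F (β 2) =
      (∏ z ∈ rootsPlus, F z) * ∏ z ∈ rootsMinus, F z := by
  have hinj : Function.Injective fun β : DirichletCharacter ℂ 19 ↦ β 2 :=
    fun _ _ h ↦ dirichletCharacter_nineteen_ext h
  rw [← Finset.prod_union disjoint_rootsPlus_rootsMinus,
    ← Finset.prod_image (s := ({1}ᶜ : Finset (DirichletCharacter ℂ 19))) (g := fun β ↦ β 2)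
      hinj.injOn (f := F)]
  congr 1
  refine Finset.eq_of_subset_of_card_le ?_ ?_
  · intro z hz
    obtain ⟨β, hβ, rfl⟩ := Finset.mem_image.mp hz
    have hβ1 : β ≠ 1 := by simpa using hβ
    have h18 : (β 2 ^ 9 - 1) * (β 2 ^ 9 + 1) = 0 := by
      have : β 2 ^ 18 = 1 := by
        rw [← map_pow, show (2 : ZMod 19) ^ 18 = 1 by decide, map_one]
      linear_combination this
    rw [Finset.mem_union, mem_rootsPlus, mem_rootsMinus]
    rcases mul_eq_zero.mp h18 with h | h
    · exact Or.inl ⟨fun h ↦ hβ1 (hinj (h.trans (MulChar.one_apply (by decide)).symm)),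
        sub_eq_zero.mp h⟩
    · exact Or.inr (eq_neg_of_add_eq_zero_left h)
  · rw [Finset.card_union_of_disjoint disjoint_rootsPlus_rootsMinus, card_rootsPlus,
      card_rootsMinus, Finset.card_image_of_injective _ hinj, Finset.card_compl,
      Finset.card_singleton, ← Nat.card_eq_fintype_card,
      card_eq_totient_of_hasEnoughRootsOfUnity, Nat.totient_prime (by norm_num)]

variable (K : Type*) [Field K] [NumberField K] [IsCyclotomicExtension {57} ℚ K]

theorem char57_inv (β : DirichletCharacter ℂ 19) :
    (char57 chi3 β)⁻¹ = char57 chi3 β⁻¹ := by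
  have hi : chi3⁻¹ = chi3 := dirichletCharacter_three_ext (by
    rw [show (2 : ZMod 3) = -1 by decide, inv_apply_neg_one])
  rw [char57, char57, mul_inv, ← map_inv, ← map_inv, hi]

theorem dedekindZeta_residue_mul_eq :
    dedekindZeta_residue K * (3 * √3 * √19 ^ 8 * (19 * √19) ^ 9 * √57 ^ 9 * (57 * √57) ^ 8) =
      Real.pi ^ 18 * (∏ z ∈ rootsPlus, ‖logSum19 z‖) * (∏ z ∈ rootsMinus, ‖bernSum19 z‖) *
        (∏ z ∈ rootsMinus, ‖logSum57 z‖) * ∏ z ∈ rootsPlus, ‖bernSum57 z‖ := by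
  classical
  have h := congrArg norm (dedekindZeta_residue_57 K)
  rw [Complex.norm_real, Real.norm_of_nonneg (dedekindZeta_residue_pos K).le, norm_mul, norm_mul,
    norm_prod, norm_prod] at h
  have hinv (F : DirichletCharacter ℂ 19 → ℝ) :
      ∏ β ∈ ({1}ᶜ : Finset (DirichletCharacter ℂ 19)), F β =
        ∏ β ∈ ({1}ᶜ : Finset (DirichletCharacter ℂ 19)), F β⁻¹ :=
    Finset.prod_bij' (fun β _ ↦ β⁻¹) (fun β _ ↦ β⁻¹) (by simp) (by simp) (by simp) (by simp)
      (by simp)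
  let F : ℂ → ℝ := fun z ↦ if z ^ 9 = 1 then ‖logSum19 z‖ / √19 else
    Real.pi * ‖bernSum19 z‖ / (19 * √19)
  let G : ℂ → ℝ := fun z ↦ if z ^ 9 = 1 then Real.pi * ‖bernSum57 z‖ / (57 * √57) else
    ‖logSum57 z‖ / √57
  have hcases (β : DirichletCharacter ℂ 19) : β 2 ^ 9 = 1 ∨ β 2 ^ 9 = -1 := by
    have : β 2 ^ 18 = 1 := by
      rw [← map_pow, show (2 : ZMod 19) ^ 18 = 1 by decide, map_one]
    exact sq_eq_one_iff.mp (by rw [← pow_mul, this])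
  have hF : ∀ β ∈ ({1}ᶜ : Finset (DirichletCharacter ℂ 19)), ‖β⁻¹.LFunction 1‖ = F (β 2) := by
    intro β hβ
    have hβ1 : β ≠ 1 := by simpa using hβ
    rcases hcases β with h9 | h9
    · simp only [F, h9, if_true]
      rw [← norm_LFunction_inv_nineteen_even hβ1 h9]
      field_simp
    · have : (-1 : ℂ) ≠ 1 := by norm_num
      simp only [F, h9, this, if_false]
      rw [← norm_LFunction_inv_nineteen_odd h9]
      field_simp
  have hG : ∀ β ∈ ({1}ᶜ : Finset (DirichletCharacter ℂ 19)),
      ‖(char57 chi3 β⁻¹).LFunction 1‖ = G (β 2) := by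
    intro β hβ
    have hβ1 : β ≠ 1 := by simpa using hβ
    rw [← char57_inv]
    rcases hcases β with h9 | h9
    · simp only [G, h9, if_true]
      rw [← norm_LFunction_inv_57_odd hβ1 h9]
      field_simp
    · have : (-1 : ℂ) ≠ 1 := by norm_num
      simp only [G, h9, this, if_false]
      rw [← norm_LFunction_inv_57_even h9]
      field_simp
  rw [hinv, hinv fun β ↦ ‖(char57 chi3 β).LFunction 1‖, Finset.prod_congr rfl hF,
    Finset.prod_congr rfl hG, prod_dirichletCharacter_nineteen,
    prod_dirichletCharacter_nineteen] at h
  have hp {z : ℂ} (hz : z ∈ rootsPlus) : z ^ 9 = 1 := (mem_rootsPlus.mp hz).2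
  have hm {z : ℂ} (hz : z ∈ rootsMinus) : ¬ z ^ 9 = 1 := by
    rw [mem_rootsMinus.mp hz]
    norm_num
  rw [Finset.prod_congr rfl fun z hz ↦ if_pos (hp hz),
    Finset.prod_congr rfl fun z hz ↦ if_neg (hm hz),
    Finset.prod_congr rfl fun z hz ↦ if_pos (hp hz),
    Finset.prod_congr rfl fun z hz ↦ if_neg (hm hz)] at h
  simp only [Finset.prod_div_distrib, Finset.prod_mul_distrib, Finset.prod_const, card_rootsPlus,
    card_rootsMinus] at h
  rw [h]
  have h3 := norm_LFunction_chi3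
  field_simp
  rw [← h3]
  ring

end ResidueValues

section BernoulliProducts

theorem norm_form_cubic {ω : ℂ} (hω : ω ^ 2 + ω + 1 = 0) (a b c y : ℂ) :
    (a + b * y + c * y ^ 2) * (a + b * (ω * y) + c * (ω * y) ^ 2) *
      (a + b * (ω ^ 2 * y) + c * (ω ^ 2 * y) ^ 2) =
      a ^ 3 + b ^ 3 * y ^ 3 + c ^ 3 * y ^ 6 - 3 * a * b * c * y ^ 3 := by
  grind

theorem bernSum19_neg {y : ℂ} (hy : y ^ 9 = 1) : bernSum19 (-y) =
    (-17 + 3 * y ^ 3 - 5 * y ^ 6) + (15 + 13 * y ^ 3 - 9 * y ^ 6) * y +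
      (-11 - 7 * y ^ 3 - y ^ 6) * y ^ 2 := by
  simp only [bernSum19, Finset.sum_range_succ, Finset.sum_range_zero]
  norm_num
  linear_combination (-18 + 17 * y - 15 * y ^ 2 + 11 * y ^ 3 - 3 * y ^ 4 + 6 * y ^ 5
    - 12 * y ^ 6 + 5 * y ^ 7 - 10 * y ^ 8) * hy

theorem bernSum57_eq {y : ℂ} (hy : y ^ 9 = 1) : bernSum57 y =
    38 * ((-1 + 2 * y ^ 3 - y ^ 6) + (2 - y ^ 3 + 2 * y ^ 6) * y +
      (-1 - y ^ 3 - y ^ 6) * y ^ 2) := by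
  simp only [bernSum57, Finset.sum_range_succ, Finset.sum_range_zero]
  norm_num
  linear_combination (17 + 53 * y + 11 * y ^ 2 + 41 * y ^ 3 - 13 * y ^ 4 - 7 * y ^ 5 + 5 * y ^ 6
    + 29 * y ^ 7 - 37 * y ^ 8) * hy

theorem nthRootsFinset_nine {w : ℂ} (hw : IsPrimitiveRoot w 9) :
    Polynomial.nthRootsFinset 9 (1 : ℂ) = (Finset.range 9).image fun k ↦ w ^ k := by
  symm
  refine Finset.eq_of_subset_of_card_le ?_ ?_
  · intro z hz
    obtain ⟨k, -, rfl⟩ := Finset.mem_image.mp hz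
    rw [Polynomial.mem_nthRootsFinset (by norm_num), ← pow_mul, mul_comm, pow_mul, hw.pow_eq_one,
      one_pow]
  · rw [hw.card_nthRootsFinset, Finset.card_image_of_injOn, Finset.card_range]
    exact fun i hi j hj h ↦ hw.pow_inj (Finset.mem_range.mp hi) (Finset.mem_range.mp hj) h

theorem IsPrimitiveRoot.cube_relation_nine {w : ℂ} (hw : IsPrimitiveRoot w 9) :
    (w ^ 3) ^ 2 + w ^ 3 + 1 = 0 := by
  have h1 : w ^ 3 - 1 ≠ 0 :=
    sub_ne_zero.mpr (hw.pow_ne_one_of_pos_of_lt (by norm_num) (by norm_num))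
  refine (mul_eq_zero.mp ?_).resolve_left h1
  linear_combination hw.pow_eq_one

theorem prod_norm_bernSum19 : ∏ z ∈ rootsMinus, ‖bernSum19 z‖ = 2 ^ 8 * 19 ^ 8 := by
  have hw := Complex.isPrimitiveRoot_exp 9 (by norm_num)
  set w := Complex.exp (2 * Real.pi * Complex.I / ((9 : ℕ) : ℂ))
  have hω := hw.cube_relation_nine
  have h9 := hw.pow_eq_one
  have key (y : ℂ) (hy : y ^ 9 = 1) :
      bernSum19 (-y) * bernSum19 (-(w ^ 3 * y)) * bernSum19 (-((w ^ 3) ^ 2 * y)) =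
        -1444 - 15884 * y ^ 3 - 10108 * (y ^ 3) ^ 2 := by
    have e1 : (w ^ 3 * y) ^ 3 = y ^ 3 := by linear_combination y ^ 3 * h9
    have e2 : ((w ^ 3) ^ 2 * y) ^ 3 = y ^ 3 := by linear_combination y ^ 3 * (w ^ 9 + 1) * h9
    have hpow (x : ℂ) (hx : x ^ 3 = y ^ 3) : x ^ 9 = 1 ∧ x ^ 6 = y ^ 6 := by
      constructor
      · linear_combination (x ^ 6 + x ^ 3 * y ^ 3 + y ^ 6) * hx + hy
      · linear_combination (x ^ 3 + y ^ 3) * hx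
    rw [bernSum19_neg hy, bernSum19_neg (hpow _ e1).1, bernSum19_neg (hpow _ e2).1, e1, e2,
      (hpow _ e1).2, (hpow _ e2).2, norm_form_cubic hω]
    generalize hu : y ^ 3 = u
    have hu3 : u ^ 3 = 1 := by rw [← hu, ← pow_mul, hy]
    rw [show y ^ 6 = u ^ 2 by rw [← hu, ← pow_mul]]
    grind
  have hprod : ∏ k ∈ Finset.range 9, bernSum19 (-(w ^ k)) = -(2 ^ 8 * 19 ^ 8) := by
    have k0 := key 1 (one_pow 9)
    have k1 := key w h9
    have k2 := key (w ^ 2) (by rw [← pow_mul, mul_comm, pow_mul, h9, one_pow])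
    have hn := norm_form_cubic hω (-1444) (-15884) (-10108) 1
    simp only [Finset.prod_range_succ, Finset.prod_range_zero, pow_zero, one_mul, pow_one]
    ring_nf at k0 k1 k2 hn ⊢
    grind
  rw [rootsMinus_eq_image, Finset.prod_image neg_injective.injOn, nthRootsFinset_nine hw,
    Finset.prod_image, ← norm_prod, hprod]
  · norm_num
  · exact fun i hi j hj h ↦ hw.pow_inj (Finset.mem_range.mp hi) (Finset.mem_range.mp hj) h

theorem rootsPlus_eq_image {w : ℂ} (hw : IsPrimitiveRoot w 9) :
    rootsPlus = ((Finset.range 9).erase 0).image fun k ↦ w ^ k := by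
  rw [rootsPlus, nthRootsFinset_nine hw]
  ext z
  simp only [Finset.mem_erase, Finset.mem_image]
  constructor
  · rintro ⟨hz, k, hk, rfl⟩
    exact ⟨k, ⟨fun h ↦ hz (by rw [h, pow_zero]), hk⟩, rfl⟩
  · rintro ⟨k, ⟨h0, hk⟩, rfl⟩
    exact ⟨hw.pow_ne_one_of_pos_of_lt h0 (Finset.mem_range.mp hk), k, hk, rfl⟩

theorem IsPrimitiveRoot.injOn_pow_erase {w : ℂ} (hw : IsPrimitiveRoot w 9) :
    Set.InjOn (fun k ↦ w ^ k) ((Finset.range 9).erase 0 : Finset ℕ) :=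
  fun _ hi _ hj h ↦ hw.pow_inj (Finset.mem_range.mp (Finset.mem_of_mem_erase hi))
    (Finset.mem_range.mp (Finset.mem_of_mem_erase hj)) h

theorem prod_norm_bernSum57 : ∏ z ∈ rootsPlus, ‖bernSum57 z‖ = 9 * 114 ^ 8 := by
  have hw := Complex.isPrimitiveRoot_exp 9 (by norm_num)
  set w := Complex.exp (2 * Real.pi * Complex.I / ((9 : ℕ) : ℂ))
  have hω := hw.cube_relation_nine
  have h9 := hw.pow_eq_one
  have key (y : ℂ) (hy : y ^ 9 = 1) :
      bernSum57 y * bernSum57 (w ^ 3 * y) * bernSum57 ((w ^ 3) ^ 2 * y) =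
        1481544 - 1481544 * y ^ 3 := by
    have e1 : (w ^ 3 * y) ^ 3 = y ^ 3 := by linear_combination y ^ 3 * h9
    have e2 : ((w ^ 3) ^ 2 * y) ^ 3 = y ^ 3 := by linear_combination y ^ 3 * (w ^ 9 + 1) * h9
    have hpow (x : ℂ) (hx : x ^ 3 = y ^ 3) : x ^ 9 = 1 ∧ x ^ 6 = y ^ 6 := by
      constructor
      · linear_combination (x ^ 6 + x ^ 3 * y ^ 3 + y ^ 6) * hx + hy
      · linear_combination (x ^ 3 + y ^ 3) * hx
    have hn := norm_form_cubic hω (-1 + 2 * y ^ 3 - y ^ 6) (2 - y ^ 3 + 2 * y ^ 6)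
      (-1 - y ^ 3 - y ^ 6) y
    have hpull (a b c : ℂ) : 38 * a * (38 * b) * (38 * c) = 38 ^ 3 * (a * b * c) := by ring
    rw [bernSum57_eq hy, bernSum57_eq (hpow _ e1).1, bernSum57_eq (hpow _ e2).1, e1, e2,
      (hpow _ e1).2, (hpow _ e2).2, hpull, hn]
    generalize hu : y ^ 3 = u
    have hu3 : u ^ 3 = 1 := by rw [← hu, ← pow_mul, hy]
    rw [show y ^ 6 = u ^ 2 by rw [← hu, ← pow_mul]]
    grind
  have hcube : bernSum57 (w ^ 3) * bernSum57 (w ^ 6) = 38988 := by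
    have e1 : (w ^ 3) ^ 9 = 1 := by rw [← pow_mul, mul_comm, pow_mul, h9, one_pow]
    have e2 : (w ^ 6) ^ 9 = 1 := by rw [← pow_mul, mul_comm, pow_mul, h9, one_pow]
    rw [bernSum57_eq e1, bernSum57_eq e2, show w ^ 6 = (w ^ 3) ^ 2 by ring]
    have h3 : (w ^ 3) ^ 3 = 1 := by rw [← pow_mul, h9]
    generalize w ^ 3 = v at *
    have h6 : v ^ 6 = 1 := by linear_combination (v ^ 3 + 1) * h3
    have h6' : (v ^ 2) ^ 6 = 1 := by linear_combination (v ^ 6 + 1) * h6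
    have h3' : (v ^ 2) ^ 3 = 1 := by linear_combination h6
    rw [h3, h6, h3', h6']
    grind
  have hprod : ∏ k ∈ (Finset.range 9).erase 0, bernSum57 (w ^ k) = 9 * 114 ^ 8 := by
    have k1 := key w h9
    have k2 := key (w ^ 2) (by rw [← pow_mul, mul_comm, pow_mul, h9, one_pow])
    rw [show (Finset.range 9).erase 0 = {1, 2, 3, 4, 5, 6, 7, 8} by decide]
    iterate 7 rw [Finset.prod_insert (by decide)]
    rw [Finset.prod_singleton]
    ring_nf at k1 k2 hcube ⊢
    grind
  rw [rootsPlus_eq_image hw, Finset.prod_image hw.injOn_pow_erase, ← norm_prod, hprod]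
  norm_num
end BernoulliProducts

section ClassNumberFormula

open IsDedekindDomain NumberField Filter Topology

variable (K : Type*) [Field K] [NumberField K] [IsCyclotomicExtension {57} ℚ K]

theorem abs_discr_57 : |(discr K : ℝ)| = (3 ^ 9 * 19 ^ 17) ^ 2 := by
  have h := IsCyclotomicExtension.Rat.natAbs_discr 57 K
  have hp : Nat.primeFactors 57 = {3, 19} := by decide +kernel
  have ht : Nat.totient 57 = 36 := by decide +kernel
  rw [hp, ht, Finset.prod_pair (by norm_num)] at h
  norm_num at h
  rw [← Int.cast_abs, Int.abs_eq_natAbs, h]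
  norm_num

theorem regulator_mul_classNumber_eq :
    Units.regulator K * classNumber K =
      9 / 2 * ((∏ z ∈ rootsPlus, ‖logSum19 z‖) * ∏ z ∈ rootsMinus, ‖logSum57 z‖) := by
  have ht : Nat.totient 57 = 36 := by decide +kernel
  have h := dedekindZeta_residue_mul_eq K
  rw [dedekindZeta_residue_def,
    IsCyclotomicExtension.Rat.nrRealPlaces_eq_zero (n := 57) K (by norm_num),
    IsCyclotomicExtension.Rat.nrComplexPlaces_eq_totient_div_two 57 K, ht,
    IsCyclotomicExtension.Rat.torsionOrder_eq (n := 57) (K := K), if_neg (by decide), abs_discr_57,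
    Real.sqrt_sq (by positivity), prod_norm_bernSum19, prod_norm_bernSum57,
    show (57 : ℝ) = 19 * 3 by norm_num, Real.sqrt_mul (by norm_num)] at h
  have h19 : √(19 : ℝ) ^ 34 = 19 ^ 17 := by
    rw [show 34 = 2 * 17 by norm_num, pow_mul, Real.sq_sqrt (by norm_num)]
  have h3 : √(3 : ℝ) ^ 18 = 3 ^ 9 := by
    rw [show 18 = 2 * 9 by norm_num, pow_mul, Real.sq_sqrt (by norm_num)]
  generalize Units.regulator K = R at *
  generalize (classNumber K : ℝ) = c at *
  generalize ∏ z ∈ rootsPlus, ‖logSum19 z‖ = E at *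
  generalize ∏ z ∈ rootsMinus, ‖logSum57 z‖ = F at *
  generalize √(19 : ℝ) = x at *
  generalize √(3 : ℝ) = y at *
  have hden : 3 * y * x ^ 8 * (19 * x) ^ 9 * (x * y) ^ 9 * (19 * 3 * (x * y)) ^ 8 =
      3 * 19 ^ 9 * 57 ^ 8 * 19 ^ 17 * 3 ^ 9 := by
    linear_combination (3 * 19 ^ 9 * 57 ^ 8 * y ^ 18) * h19 + (3 * 19 ^ 9 * 57 ^ 8 * 19 ^ 17) * h3
  rw [hden] at h
  have hpi : Real.pi ^ 18 ≠ 0 := by positivity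
  field_simp at h
  apply mul_left_cancel₀ hpi
  norm_num at h
  linear_combination h / 1664997642832198238208
end ClassNumberFormula

section Circulant

open Matrix ZMod

variable {n : ℕ} [NeZero n]

theorem sum_stdAddChar_mul (k : ZMod n) :
    ∑ j : ZMod n, stdAddChar (j * k) = if k = 0 then (n : ℂ) else 0 := by
  have h := AddChar.sum_mulShift k (ψ := stdAddChar (N := n)) (isPrimitive_stdAddChar n)
  rw [h, ZMod.card]
  split_ifs <;> simp

/-- The Fourier matrix of `ZMod n`. -/
noncomputable def fourierMatrix (n : ℕ) [NeZero n] : Matrix (ZMod n) (ZMod n) ℂ :=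
  of fun i j ↦ stdAddChar (i * j)

theorem det_fourierMatrix_ne_zero : (fourierMatrix n).det ≠ 0 := by
  have hn : (n : ℂ) ≠ 0 := NeZero.ne _
  have h : fourierMatrix n * (of fun i j ↦ stdAddChar (-(i * j))) = (n : ℂ) • 1 := by
    ext i j
    rw [mul_apply, Matrix.smul_apply, one_apply]
    simp only [fourierMatrix, of_apply, ← AddChar.map_add_eq_mul]
    have h1 := sum_stdAddChar_mul (i - j)
    simp_rw [show ∀ x : ZMod n, i * x + -(x * j) = x * (i - j) from fun x ↦ by ring]
    rw [h1]
    simp only [sub_eq_zero, smul_eq_mul, mul_ite, mul_one, mul_zero]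
  intro h0
  have h2 := congrArg det h
  rw [det_mul, h0, zero_mul, det_smul, det_one, mul_one] at h2
  exact pow_ne_zero _ hn h2.symm

theorem norm_det_of_add (f : ZMod n → ℂ) :
    ‖(of fun i j ↦ f (i + j)).det‖ = ∏ k, ‖∑ j, f j * stdAddChar (j * k)‖ := by
  have h : (of fun i j ↦ f (i + j)) * fourierMatrix n =
      (fourierMatrix n).map (starRingEnd ℂ) *
        diagonal fun k ↦ ∑ j, f j * stdAddChar (j * k) := by
    ext i k
    rw [mul_diagonal, mul_apply, map_apply, Finset.mul_sum]
    refine Fintype.sum_equiv (Equiv.addLeft i) _ _ fun j ↦ ?_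
    simp only [fourierMatrix, of_apply, Equiv.coe_addLeft]
    rw [← AddChar.map_neg_eq_conj, mul_left_comm, ← AddChar.map_add_eq_mul]
    congr 2
    ring
  have h2 := congrArg (fun A ↦ ‖det A‖) h
  simp only [det_mul, det_diagonal, norm_mul, norm_prod] at h2
  rw [← RingHom.mapMatrix_apply, ← RingHom.map_det, Complex.norm_conj, mul_comm] at h2
  exact mul_left_cancel₀ (norm_ne_zero_iff.mpr det_fourierMatrix_ne_zero) h2

theorem norm_det_updateRow_one (f : ZMod n → ℂ) (i₀ : ZMod n) :
    ‖((of fun i j ↦ f (i + j)).updateRow i₀ 1).det‖ =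
      ∏ k ∈ {0}ᶜ, ‖∑ j, f j * stdAddChar (j * k)‖ := by
  have hn : (n : ℂ) ≠ 0 := NeZero.ne _
  set t : ℂ := (1 - ∑ j, f j) / n with ht
  set g : ZMod n → ℂ := fun j ↦ f j + t with hg
  have hsum : ∑ j, g j = 1 := by
    simp only [hg, Finset.sum_add_distrib, Finset.sum_const, Finset.card_univ, ZMod.card,
      nsmul_eq_mul, ht]
    field_simp
    ring
  have h1 := norm_det_of_add g
  have h2 : ∀ k ∈ ({0}ᶜ : Finset (ZMod n)), ‖∑ j, g j * stdAddChar (j * k)‖ =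
      ‖∑ j, f j * stdAddChar (j * k)‖ := by
    intro k hk
    simp only [Finset.mem_compl, Finset.mem_singleton] at hk
    simp only [hg, add_mul, Finset.sum_add_distrib, ← Finset.mul_sum, sum_stdAddChar_mul, if_neg hk,
      mul_zero, add_zero]
  rw [← Finset.prod_congr rfl h2]
  rw [← Finset.prod_mul_prod_compl {0}, Finset.prod_singleton] at h1
  simp only [mul_zero, AddChar.map_zero_eq_one, mul_one, hsum, norm_one, one_mul] at h1
  rw [← h1]
  congr 1
  have h3 := det_updateRow_sum (of fun i j ↦ g (i + j)) i₀ (fun _ ↦ 1)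
  rw [one_smul] at h3
  rw [← h3]
  have h4 : (∑ k, (1 : ℂ) • (of fun i j ↦ g (i + j)) k) = 1 := by
    ext j
    rw [Finset.sum_apply, Pi.one_apply]
    refine Eq.trans ?_ hsum
    exact Fintype.sum_equiv (Equiv.addRight j) _ _ fun i ↦ one_mul _
  rw [h4]
  symm
  refine det_eq_of_forall_row_eq_smul_add_const (fun i ↦ if i = i₀ then 0 else t) i₀ (by simp) ?_
  intro i j
  by_cases hi : i = i₀
  · simp [hi]
  · simp [hi, hg]

end Circulant

section DistributionRelation

open Complex

theorem logOneSub_distribution {b : ℕ} (hb : ¬ 19 ∣ b) :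
    logOneSub 57 b + logOneSub 57 (b + 19) + logOneSub 57 (b + 38) = logOneSub 19 b := by
  set x := exp (2 * Real.pi * I * ((b : ℝ) / 57 : ℝ)) with hx
  set ρ := exp (2 * Real.pi * I / (3 : ℕ)) with hρ
  have hprim : IsPrimitiveRoot ρ 3 := isPrimitiveRoot_exp 3 (by norm_num)
  have hρ2 : ρ ^ 2 + ρ + 1 = 0 := by
    have h1 : ρ - 1 ≠ 0 := sub_ne_zero.mpr (hprim.ne_one (by norm_num))
    refine (mul_eq_zero.mp ?_).resolve_left h1
    linear_combination hprim.pow_eq_one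
  have e1 : exp (2 * Real.pi * I * (((b + 19 : ℕ) : ℝ) / (57 : ℕ) : ℝ)) = ρ * x := by
    rw [hx, hρ, ← exp_add]
    congr 1
    push_cast
    ring
  have e2 : exp (2 * Real.pi * I * (((b + 38 : ℕ) : ℝ) / (57 : ℕ) : ℝ)) = ρ ^ 2 * x := by
    rw [hx, hρ, ← exp_nat_mul, ← exp_add]
    congr 1
    push_cast
    ring
  have e3 : exp (2 * Real.pi * I * ((b : ℝ) / (19 : ℕ) : ℝ)) = x ^ 3 := by
    rw [hx, ← exp_nat_mul]
    congr 1
    push_cast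
    ring
  have hprod : (1 - x) * (1 - ρ * x) * (1 - ρ ^ 2 * x) = 1 - x ^ 3 := by
    grind
  have hne : 1 - x ^ 3 ≠ 0 := by
    rw [← e3, sub_ne_zero, ne_comm, Ne, exp_eq_one_iff]
    rintro ⟨m, hm⟩
    have h2 : (2 * Real.pi * I : ℂ) ≠ 0 := two_pi_I_ne_zero
    rw [mul_comm (m : ℂ)] at hm
    have h3 := mul_left_cancel₀ h2 hm
    push_cast at h3
    rw [div_eq_iff (by norm_num)] at h3
    have h4 : ((b : ℤ) : ℂ) = ((m * 19 : ℤ) : ℂ) := by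
      push_cast
      exact h3
    have h5 := Int.cast_injective h4
    omega
  rw [← hprod] at hne
  have n3 := right_ne_zero_of_mul hne
  have n2 := right_ne_zero_of_mul (left_ne_zero_of_mul hne)
  have n1 := left_ne_zero_of_mul (left_ne_zero_of_mul hne)
  rw [logOneSub, logOneSub, logOneSub, logOneSub, e1, e2, e3, ← hprod, norm_mul, norm_mul,
    Real.log_mul (by positivity) (by positivity), Real.log_mul (by positivity) (by positivity)]
  rfl

theorem logOneSub_57_three_mul (m : ℕ) : logOneSub 57 (3 * m) = logOneSub 19 m := by
  rw [logOneSub, logOneSub]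
  congr 4
  push_cast
  congr 1
  ring

theorem logOneSub_neg {N a b : ℕ} [NeZero N] (h : N ∣ a + b) :
    logOneSub N a = logOneSub N b := by
  have h1 : (b : ZMod N) = -(a : ZMod N) := by
    rw [eq_neg_iff_add_eq_zero, ← Nat.cast_add, add_comm, ZMod.natCast_eq_zero_iff]
    exact h
  rw [← logOneSub_mod N b, ← ZMod.val_natCast, h1, logOneSub_val_neg, ZMod.val_natCast,
    logOneSub_mod]

theorem logOneSub_19_two_pow_add (k : ℕ) :
    logOneSub 19 (2 ^ (k + 9)) = logOneSub 19 (2 ^ k) := by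
  refine logOneSub_neg ?_
  rw [pow_add]
  exact ⟨27 * 2 ^ k, by ring⟩

theorem logOneSub_57_add (k : ℕ) : logOneSub 57 (40 ^ k) + logOneSub 57 (40 ^ (k + 9)) =
    logOneSub 19 (2 ^ k) - logOneSub 19 (2 ^ (k + 5)) := by
  have h40 : 40 ^ k ≡ 2 ^ k [MOD 19] := Nat.ModEq.pow k (by decide)
  have h41 : 40 ^ k ≡ 1 ^ k [MOD 3] := Nat.ModEq.pow k (by decide)
  have h2 : ¬ 19 ∣ 40 ^ k := fun h ↦ by
    have := Nat.Prime.dvd_of_dvd_pow (by norm_num) h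
    omega
  rw [one_pow] at h41
  unfold Nat.ModEq at h40 h41
  have e1 : logOneSub 57 (40 ^ k + 19) = logOneSub 57 (40 ^ (k + 9)) := by
    refine logOneSub_neg ?_
    rw [pow_add]
    omega
  have e2 : logOneSub 57 (40 ^ k + 38) = logOneSub 19 (2 ^ (k + 5)) := by
    rw [logOneSub_congr (show 40 ^ k + 38 ≡ 3 * (13 * 2 ^ k) [MOD 57] by
      unfold Nat.ModEq; omega), logOneSub_57_three_mul]
    refine logOneSub_congr ?_
    unfold Nat.ModEq
    rw [pow_add]
    omega
  have e3 : logOneSub 19 (40 ^ k) = logOneSub 19 (2 ^ k) := logOneSub_congr h40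
  have := logOneSub_distribution h2
  rw [e1, e2, e3] at this
  linarith

theorem logSum57_eq {z : ℂ} (hz : z ^ 9 = 1) : logSum57 z = (1 - z ^ 4) * logSum19 z := by
  have hk (k : ℕ) : (logOneSub 57 (40 ^ (k + 9)) : ℂ) =
      logOneSub 19 (2 ^ k) - logOneSub 19 (2 ^ (k + 5)) - logOneSub 57 (40 ^ k) := by
    rw [← ofReal_sub, ← ofReal_sub, ← logOneSub_57_add k]
    congr 1
    ring
  have hk' (k : ℕ) : (logOneSub 19 (2 ^ (k + 9)) : ℂ) = logOneSub 19 (2 ^ k) := by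
    rw [logOneSub_19_two_pow_add]
  have h57 : logSum57 z = 2 * ∑ k ∈ Finset.range 9,
      z ^ k * (logOneSub 19 (2 ^ k) - logOneSub 19 (2 ^ (k + 5)) : ℂ) := by
    rw [logSum57, show 18 = 9 + 9 from rfl, Finset.sum_range_add, ← Finset.sum_add_distrib,
      Finset.mul_sum]
    refine Finset.sum_congr rfl fun k _ ↦ ?_
    rw [pow_add z 9 k, hz, add_comm 9 k]
    push_cast
    rw [hk]
    ring
  have h19 : logSum19 z = 2 * ∑ k ∈ Finset.range 9, z ^ k * (logOneSub 19 (2 ^ k) : ℂ) := by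
    rw [logSum19, show 18 = 9 + 9 from rfl, Finset.sum_range_add, ← Finset.sum_add_distrib,
      Finset.mul_sum]
    refine Finset.sum_congr rfl fun k _ ↦ ?_
    rw [pow_add z 9 k, hz, add_comm 9 k, hk']
    ring
  have hshift : ∑ k ∈ Finset.range 9, z ^ k * (logOneSub 19 (2 ^ (k + 5)) : ℂ) =
      z ^ 4 * ∑ k ∈ Finset.range 9, z ^ k * (logOneSub 19 (2 ^ k) : ℂ) := by
    have key (f : ℕ → ℂ) (hf : ∀ k, f (k + 9) = f k) : ∑ k ∈ Finset.range 9, z ^ k * f (k + 5) =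
        z ^ 4 * ∑ k ∈ Finset.range 9, z ^ k * f k := by
      have h0 := hf 0
      have h1 := hf 1
      have h2 := hf 2
      have h3 := hf 3
      have h4 := hf 4
      simp only [Nat.reduceAdd] at h0 h1 h2 h3 h4
      simp only [Finset.sum_range_succ, Finset.range_zero, Finset.sum_empty, Nat.reduceAdd,
        h0, h1, h2, h3, h4]
      linear_combination (-(f 5 + z * f 6 + z ^ 2 * f 7 + z ^ 3 * f 8)) * hz
    exact key (fun k ↦ (logOneSub 19 (2 ^ k) : ℂ)) hk'
  rw [h57, h19]
  simp_rw [mul_sub]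
  rw [Finset.sum_sub_distrib, hshift]
  ring

theorem prod_norm_logSum57_rootsPlus :
    ∏ z ∈ rootsPlus, ‖logSum57 z‖ = 9 * ∏ z ∈ rootsPlus, ‖logSum19 z‖ := by
  have hw : IsPrimitiveRoot (exp (2 * Real.pi * I / (9 : ℕ))) 9 :=
    isPrimitiveRoot_exp 9 (by norm_num)
  set w := exp (2 * Real.pi * I / (9 : ℕ))
  have hw4 : IsPrimitiveRoot (w ^ 4) 9 := hw.pow_of_coprime 4 (by norm_num)
  have h9 : ∏ z ∈ rootsPlus, ‖1 - z ^ 4‖ = 9 := by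
    have h := (show IsPrimitiveRoot (w ^ 4) (8 + 1) from hw4).prod_one_sub_pow_eq_order
    rw [rootsPlus_eq_image hw, Finset.prod_image hw.injOn_pow_erase]
    rw [← norm_prod]
    rw [show ((Finset.range 9).erase 0) = (Finset.range 8).image (· + 1) by decide,
      Finset.prod_image (by simp)]
    simp_rw [← pow_mul, mul_comm _ 4, pow_mul]
    rw [h]
    norm_num
  rw [← h9, ← Finset.prod_mul_distrib]
  refine Finset.prod_congr rfl fun z hz ↦ ?_
  rw [logSum57_eq (mem_rootsPlus.mp hz).2, norm_mul]

end DistributionRelation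

section CyclotomicUnits

open NumberField Complex Matrix ZMod

theorem prod_compl_zero_stdAddChar (F : ℂ → ℝ) :
    ∏ k ∈ ({0}ᶜ : Finset (ZMod 18)), F (stdAddChar k) =
      (∏ z ∈ rootsPlus, F z) * ∏ z ∈ rootsMinus, F z := by
  have hinj : Function.Injective (stdAddChar : AddChar (ZMod 18) ℂ) := injective_stdAddChar
  rw [← Finset.prod_union disjoint_rootsPlus_rootsMinus,
    ← Finset.prod_image (s := ({0}ᶜ : Finset (ZMod 18))) (f := F) hinj.injOn]
  refine Finset.prod_congr (Finset.eq_of_subset_of_card_le ?_ ?_) fun _ _ ↦ rfl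
  · intro z hz
    obtain ⟨k, hk, rfl⟩ := Finset.mem_image.mp hz
    have h18 : (stdAddChar k : ℂ) ^ 18 = 1 := by
      rw [← AddChar.map_nsmul_eq_pow, ← AddChar.map_zero_eq_one (stdAddChar (N := 18))]
      congr 1
      exact (by decide : ∀ k : ZMod 18, 18 • k = 0) k
    have hne : (stdAddChar k : ℂ) ≠ 1 := by
      rw [← AddChar.map_zero_eq_one (stdAddChar (N := 18)), hinj.ne_iff]
      simpa using hk
    rw [Finset.mem_union, mem_rootsPlus, mem_rootsMinus]
    have : ((stdAddChar k : ℂ) ^ 9 - 1) * ((stdAddChar k : ℂ) ^ 9 + 1) = 0 := by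
      linear_combination h18
    rcases mul_eq_zero.mp this with h | h
    · exact Or.inl ⟨hne, sub_eq_zero.mp h⟩
    · exact Or.inr (eq_neg_of_add_eq_zero_left h)
  · rw [Finset.card_union_of_disjoint disjoint_rootsPlus_rootsMinus, card_rootsPlus,
      card_rootsMinus, Finset.card_image_of_injective _ hinj, Finset.card_compl, ZMod.card]
    decide

theorem logOneSub_57_val_add (i j : ZMod 18) :
    logOneSub 57 (40 ^ (i + j).val) = logOneSub 57 (40 ^ (i.val + j.val)) := by
  refine logOneSub_congr ?_
  rw [ZMod.val_add]
  conv_rhs => rw [← Nat.mod_add_div (i.val + j.val) 18, pow_add, pow_mul]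
  simpa using ((Nat.ModEq.pow ((i.val + j.val) / 18)
    (show 40 ^ 18 ≡ 1 [MOD 57] by decide)).mul_left (40 ^ ((i.val + j.val) % 18))).symm

theorem abs_det_logOneSub_57 :
    |((of fun i j : ZMod 18 ↦ 2 * logOneSub 57 (40 ^ (i.val + j.val))).updateRow 17 1).det| =
      (∏ z ∈ rootsPlus, ‖logSum57 z‖) * ∏ z ∈ rootsMinus, ‖logSum57 z‖ := by
  have h := norm_det_updateRow_one (n := 18) (fun j ↦ ((2 * logOneSub 57 (40 ^ j.val) : ℝ) : ℂ)) 17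
  rw [← prod_compl_zero_stdAddChar (fun z ↦ ‖logSum57 z‖), ← Real.norm_eq_abs, ← Complex.norm_real]
  convert h using 2
  · rw [← Complex.ofRealHom_eq_coe, RingHom.map_det]
    congr 1
    ext i j
    by_cases hi : i = 17
    · subst hi
      simp
    · simp [updateRow_ne hi, logOneSub_57_val_add]
  · rename_i k hk
    congr 1
    rw [logSum57, Finset.sum_range]
    refine Fintype.sum_equiv (Equiv.refl (ZMod 18)) _ _ fun j ↦ ?_
    have hj : stdAddChar (N := 18) k ^ ZMod.val (n := 18) j = stdAddChar (j * k) := by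
      rw [← AddChar.map_nsmul_eq_pow, nsmul_eq_mul, ZMod.natCast_zmod_val]
    exact (mul_comm _ _).trans (congrArg _ hj)

variable {K : Type*} [Field K] [NumberField K] [IsCyclotomicExtension {57} ℚ K] {ζ : K}
  (hζ : IsPrimitiveRoot ζ 57)

theorem IsPrimitiveRoot.isUnit_one_sub_toInteger_57 (hζ : IsPrimitiveRoot ζ 57) :
    IsUnit (1 - hζ.toInteger) := by
  have h := hζ.norm_toInteger_sub_one_eq_one (by norm_num) (by
    intro p hp k hk
    have h3 : 3 ∣ p := Nat.prime_three.dvd_of_dvd_pow (hk ▸ (by norm_num : 3 ∣ 57))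
    have h19 : 19 ∣ p := Nat.Prime.dvd_of_dvd_pow (by norm_num) (hk ▸ (by norm_num : 19 ∣ 57))
    have := (Nat.prime_dvd_prime_iff_eq Nat.prime_three hp).mp h3
    omega)
  rw [← neg_sub, IsUnit.neg_iff, ← Ideal.span_singleton_eq_top, ← Ideal.absNorm_eq_one_iff,
    Ideal.absNorm_span_singleton, h]
  rfl

/-- The cyclotomic units `1 - ζ ^ (40 ^ k)` of the `57`-th cyclotomic field. -/
noncomputable def cyclotomicUnit (k : ℕ) : (𝓞 K)ˣ :=
  ((hζ.pow_of_coprime (40 ^ k) (Nat.Coprime.pow_left k (by decide))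
    ).isUnit_one_sub_toInteger_57).unit

theorem coe_cyclotomicUnit (k : ℕ) :
    ((cyclotomicUnit hζ k : 𝓞 K) : K) = 1 - ζ ^ 40 ^ k := by
  rw [cyclotomicUnit, IsUnit.unit_spec]
  rfl

theorem exists_equiv_infinitePlace : ∃ E : ZMod 18 ≃ InfinitePlace K, ∀ i j,
    Real.log (E i (cyclotomicUnit hζ j : 𝓞 K)) = logOneSub 57 (40 ^ (i.val + j)) := by
  have hirr : Irreducible (Polynomial.cyclotomic 57 ℚ) :=
    Polynomial.cyclotomic.irreducible_rat (by norm_num)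
  have hx : IsPrimitiveRoot (exp (2 * Real.pi * I / (57 : ℕ))) 57 :=
    isPrimitiveRoot_exp 57 (by norm_num)
  set x := exp (2 * Real.pi * I / (57 : ℕ)) with hx'
  have hφ (i : ZMod 18) : ∃ φ : K →+* ℂ, φ ζ = x ^ 40 ^ i.val := by
    have hmem : x ^ 40 ^ i.val ∈ primitiveRoots 57 ℂ := by
      rw [mem_primitiveRoots (by norm_num)]
      exact hx.pow_of_coprime _ (Nat.Coprime.pow_left _ (by decide))
    refine ⟨((hζ.embeddingsEquivPrimitiveRoots ℂ hirr).symm ⟨_, hmem⟩ : K →ₐ[ℚ] ℂ), ?_⟩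
    have := hζ.embeddingsEquivPrimitiveRoots_apply_coe ℂ hirr
      ((hζ.embeddingsEquivPrimitiveRoots ℂ hirr).symm ⟨_, hmem⟩)
    rw [Equiv.apply_symm_apply] at this
    exact this.symm
  choose φ hφ using hφ
  have hbij : Function.Bijective fun i ↦ InfinitePlace.mk (φ i) := by
    rw [Fintype.bijective_iff_injective_and_card]
    constructor
    · intro i j hij
      rcases InfinitePlace.mk_eq_iff.mp hij with h | h
      · have h1 := hφ i
        rw [h, hφ j] at h1
        have h2 : x ^ (40 ^ i.val + 56 * 40 ^ j.val) = 1 := by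
          rw [pow_add, ← h1, ← pow_add, hx.pow_eq_one_iff_dvd]
          omega
        rw [hx.pow_eq_one_iff_dvd] at h2
        exact (by decide +kernel : ∀ i j : ZMod 18,
          57 ∣ 40 ^ i.val + 56 * 40 ^ j.val → i = j) i j h2
      · have h1 := hφ j
        rw [← h, ComplexEmbedding.conjugate_coe_eq, hφ i, map_pow,
          ← Complex.inv_eq_conj (hx.norm'_eq_one (by norm_num)), inv_pow,
          inv_eq_iff_eq_inv, ← mul_eq_one_iff_eq_inv₀ (pow_ne_zero _ (hx.ne_zero (by norm_num))),
          ← pow_add, hx.pow_eq_one_iff_dvd] at h1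
        exact absurd h1 ((by decide +kernel : ∀ i j : ZMod 18,
          ¬ 57 ∣ 40 ^ i.val + 40 ^ j.val) i j)
    · rw [InfinitePlace.card_eq_nrRealPlaces_add_nrComplexPlaces,
        IsCyclotomicExtension.Rat.nrRealPlaces_eq_zero (n := 57) K (by norm_num),
        IsCyclotomicExtension.Rat.nrComplexPlaces_eq_totient_div_two 57 K, ZMod.card]
      decide +kernel
  refine ⟨Equiv.ofBijective _ hbij, fun i j ↦ ?_⟩
  rw [Equiv.ofBijective_apply, InfinitePlace.apply, coe_cyclotomicUnit, map_sub, map_one, map_pow,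
    hφ, ← pow_mul, ← pow_add, logOneSub, hx', ← exp_nat_mul]
  congr 4
  push_cast
  ring

theorem exists_family_cyclotomicUnit : ∃ u : Fin (Units.rank K) → (𝓞 K)ˣ,
    Set.range u = cyclotomicUnit hζ '' Set.Iio 17 ∧ 36 * Units.regOfFamily u =
      2 * ((∏ z ∈ rootsPlus, ‖logSum57 z‖) * ∏ z ∈ rootsMinus, ‖logSum57 z‖) := by
  obtain ⟨E, hE⟩ := exists_equiv_infinitePlace hζ
  classical
  have hcard : Fintype.card {w // w ≠ E 17} = Fintype.card (Fin (Units.rank K)) := by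
    rw [Fintype.card_fin, Units.rank, Fintype.card_subtype_compl, Fintype.card_subtype_eq]
  let e := Fintype.equivOfCardEq hcard
  refine ⟨fun r ↦ cyclotomicUnit hζ (E.symm (e.symm r)).val, ?_, ?_⟩
  · ext v
    constructor
    · rintro ⟨r, rfl⟩
      refine ⟨_, ?_, rfl⟩
      have h1 : E.symm (e.symm r) ≠ 17 := fun h ↦ (e.symm r).2 (E.symm_apply_eq.mp h)
      exact (by decide : ∀ i : ZMod 18, i ≠ 17 → i.val < 17) _ h1
    · rintro ⟨k, hk, rfl⟩
      have hk : k < 17 := hk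
      have hv : ((k : ZMod 18)).val = k := ZMod.val_cast_of_lt (by omega)
      have hne : E k ≠ E 17 := fun h ↦ by
        have := congrArg ZMod.val (E.injective h)
        rw [hv] at this
        change k = 17 at this
        omega
      refine ⟨e ⟨E k, hne⟩, ?_⟩
      simp [hv]
  · have hc : IsTotallyComplex K :=
      IsCyclotomicExtension.Rat.isTotallyComplex K (n := 57) (by norm_num)
    have h := Units.finrank_mul_regOfFamily_eq_det
      (fun r ↦ cyclotomicUnit hζ (E.symm (e.symm r)).val) (E 17) e
    rw [IsCyclotomicExtension.finrank (n := 57) K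
      (Polynomial.cyclotomic.irreducible_rat (by norm_num)),
      show Nat.totient 57 = 36 by decide +kernel] at h
    rw [← abs_det_logOneSub_57]
    rw [← det_submatrix_equiv_self E] at h
    have h2 (A : Matrix (ZMod 18) (ZMod 18) ℝ) :
        2 * |(A.updateRow 17 1).det| = |(A.updateRow 17 ((2 : ℝ) • 1)).det| := by
      rw [det_updateRow_smul, abs_mul, abs_two]
    rw [h2]
    push_cast at h
    rw [h]
    congr 2
    ext i j
    rw [submatrix_apply, of_apply]
    by_cases hi : i = 17
    · subst hi
      simp [IsTotallyComplex.mult_eq]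
    · rw [updateRow_ne hi, dif_neg (E.injective.ne hi)]
      simp [IsTotallyComplex.mult_eq, hE, add_comm]

theorem classNumber_eq_nine_mul_index : classNumber K =
    9 * (Subgroup.closure (cyclotomicUnit hζ '' Set.Iio 17) ⊔ Units.torsion K).index := by
  obtain ⟨u, hu, h36⟩ := exists_family_cyclotomicUnit hζ
  have h := Units.regOfFamily_div_regulator u
  have hR := regulator_mul_classNumber_eq K
  have hpos := Units.regulator_pos K
  rw [hu, div_eq_iff hpos.ne'] at h
  rw [prod_norm_logSum57_rootsPlus] at h36
  have : Units.regulator K * (classNumber K : ℝ) = Units.regulator K *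
      (9 * (Subgroup.closure (cyclotomicUnit hζ '' Set.Iio 17) ⊔ Units.torsion K).index : ℝ) := by
    linarith
  exact_mod_cast mul_left_cancel₀ hpos.ne' this

end CyclotomicUnits

section LogMatrix

open NumberField Matrix

theorem fact_prime_229 : Fact (Nat.Prime 229) := ⟨by norm_num⟩

/-- `log229 a` is the exponent `d` with `(1 - 151 ^ a) ^ 12 = 218 ^ d` modulo `229`; here `151` has
order `57` and `218 = 151 ^ 12` has order `19`. -/
def log229 (a : ℕ) : ℕ :=
  [0, 16, 12, 11, 9, 15, 4, 6, 14, 11, 2, 8, 15, 2, 18, 2, 9, 18, 14, 7, 18, 10, 7, 0, 2, 2, 1,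
    10, 7, 17, 2, 13, 15, 16, 15, 4, 8, 17, 7, 15, 1, 12, 6, 4, 8, 3, 16, 11, 2, 6, 18, 17, 10,
    5, 8, 10, 15].getD a 0

/-- Exponents `m` of the homomorphisms `ζ ↦ 151 ^ m` from the `57`-th cyclotomic field to
`ZMod 229` that are used to detect `19`-th powers. -/
def embExponent (j : Fin 18) : ℕ := if j = 17 then 56 else 40 ^ (j : ℕ) % 57

/-- The matrix of logarithms of the cyclotomic units and of `ζ` under the homomorphisms
`ζ ↦ 151 ^ m`. -/
def logMatrix : Matrix (Fin 18) (Fin 18) (ZMod 19) := of fun j i ↦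
  if i = 17 then (embExponent j : ZMod 19)
  else (log229 (embExponent j * 40 ^ (i : ℕ) % 57) : ZMod 19)

/-- The inverse of `logMatrix`. -/
def logMatrixInv : Matrix (Fin 18) (Fin 18) (ZMod 19) :=
  !![1, 12, 14, 4, 5, 17, 2, 16, 4, 13, 9, 6, 17, 4, 0, 17, 9, 17;
    15, 8, 0, 10, 4, 1, 0, 2, 18, 4, 16, 5, 3, 5, 18, 8, 10, 16;
    8, 0, 12, 15, 13, 5, 11, 3, 15, 17, 2, 16, 10, 10, 15, 15, 16, 6;
    3, 10, 15, 3, 15, 14, 10, 17, 7, 1, 11, 2, 13, 5, 1, 0, 14, 1;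
    16, 4, 13, 15, 15, 4, 15, 0, 1, 1, 7, 15, 18, 1, 15, 8, 5, 8;
    15, 1, 5, 14, 4, 8, 16, 12, 0, 15, 0, 0, 13, 14, 3, 17, 4, 2;
    3, 0, 11, 10, 15, 16, 16, 18, 2, 15, 11, 2, 14, 9, 0, 4, 11, 18;
    9, 2, 3, 17, 0, 12, 18, 16, 17, 3, 9, 18, 5, 2, 2, 7, 7, 7;
    12, 18, 15, 7, 1, 0, 2, 17, 10, 6, 11, 14, 3, 9, 10, 8, 12, 11;
    0, 4, 17, 1, 1, 15, 15, 3, 6, 1, 0, 5, 3, 10, 4, 6, 5, 13;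
    14, 16, 2, 11, 7, 0, 11, 9, 11, 0, 1, 15, 14, 14, 12, 9, 15, 14;
    1, 5, 16, 2, 15, 0, 2, 18, 14, 5, 15, 11, 3, 7, 0, 4, 0, 5;
    7, 3, 10, 13, 18, 13, 14, 5, 3, 3, 14, 3, 18, 17, 17, 11, 3, 10;
    1, 5, 10, 5, 1, 14, 9, 2, 9, 10, 14, 7, 17, 4, 13, 3, 11, 3;
    10, 18, 15, 1, 15, 3, 0, 2, 10, 4, 12, 0, 17, 13, 18, 5, 5, 9;
    5, 8, 15, 0, 8, 17, 4, 7, 8, 6, 9, 4, 11, 3, 5, 3, 9, 12;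
    5, 10, 16, 14, 5, 4, 11, 7, 12, 5, 15, 0, 3, 11, 5, 9, 11, 4;
    11, 3, 13, 18, 11, 17, 1, 12, 8, 6, 5, 14, 9, 16, 10, 7, 15, 10]

theorem logMatrixInv_mul_logMatrix : logMatrixInv * logMatrix = 1 := by
  decide +kernel

theorem one_sub_pow_eq_pow_log229 (j : Fin 18) (i : Fin 17) :
    (1 - (151 : ZMod 229) ^ (embExponent j * 40 ^ (i : ℕ) % 57)) ^ 12 =
      218 ^ log229 (embExponent j * 40 ^ (i : ℕ) % 57) := by
  revert j i
  decide +kernel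

theorem coprime_embExponent (j : Fin 18) : (embExponent j).Coprime 57 := by
  revert j
  decide +kernel

end LogMatrix

section Index

open NumberField
open Matrix hiding zpow_add zpow_mul
variable {K : Type*} [Field K] [NumberField K] [IsCyclotomicExtension {57} ℚ K] {ζ : K}
  (hζ : IsPrimitiveRoot ζ 57)

theorem isPrimitiveRoot_151 : IsPrimitiveRoot (151 : ZMod 229) 57 :=
  IsPrimitiveRoot.mk_of_lt _ (by norm_num) (by decide +kernel) fun l h0 hl ↦
    (by decide +kernel : ∀ l < 57, 0 < l → (151 : ZMod 229) ^ l ≠ 1) l hl h0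

theorem exists_ringHom_zmod_229 {m : ℕ} (hm : m.Coprime 57) :
    ∃ ψ : 𝓞 K →+* ZMod 229, ψ hζ.toInteger = 151 ^ m := by
  have := fact_prime_229
  have hroot :
      Polynomial.aeval ((151 : ZMod 229) ^ m) (minpoly ℤ hζ.integralPowerBasis.gen) = 0 := by
    have h57 : NeZero ((57 : ℕ) : ZMod 229) := ⟨by
      rw [Ne, ZMod.natCast_eq_zero_iff]
      norm_num⟩
    rw [hζ.integralPowerBasis_gen,
      ← minpoly.algebraMap_eq (RingOfIntegers.coe_injective (K := K)) hζ.toInteger,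
      ← Polynomial.cyclotomic_eq_minpoly (show IsPrimitiveRoot (algebraMap (𝓞 K) K hζ.toInteger) 57
        from hζ) (by norm_num),
      Polynomial.aeval_def, Polynomial.eval₂_eq_eval_map, Polynomial.map_cyclotomic]
    exact Polynomial.isRoot_cyclotomic_iff.mpr (isPrimitiveRoot_151.pow_of_coprime m hm)
  refine ⟨(hζ.integralPowerBasis.lift _ hroot : 𝓞 K →ₐ[ℤ] ZMod 229), ?_⟩
  have := hζ.integralPowerBasis.lift_gen _ hroot
  rwa [hζ.integralPowerBasis_gen] at this

/-- The element `218` of order `19` in `(ℤ/229ℤ)ˣ`. -/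
def unit218 : (ZMod 229)ˣ := ⟨218, 104, by decide, by decide⟩

theorem orderOf_unit218 : orderOf unit218 = 19 := by
  have := fact_prime_nineteen
  refine orderOf_eq_prime ?_ ?_
  · ext
    decide +kernel
  · intro h
    exact absurd (congrArg Units.val h) (by decide)

theorem exists_pow_twelve_eq_of_mem_torsion {t : (𝓞 K)ˣ} (ht : t ∈ Units.torsion K) :
    ∃ k : ℕ, (t : 𝓞 K) ^ 12 = hζ.toInteger ^ (12 * k) := by
  rw [Units.torsion, CommGroup.mem_torsion] at ht
  have ht' : IsOfFinOrder ((t : 𝓞 K) : K) := by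
    obtain ⟨n, hn, h⟩ := isOfFinOrder_iff_pow_eq_one.mp ht
    refine isOfFinOrder_iff_pow_eq_one.mpr ⟨n, hn, ?_⟩
    rw [← map_pow, ← Units.val_pow_eq_pow_val, h]
    rfl
  obtain ⟨k, -, hk⟩ := hζ.exists_pow_or_neg_mul_pow_of_isOfFinOrder (by decide) ht'
  refine ⟨k, ?_⟩
  apply RingOfIntegers.ext
  change ((t : 𝓞 K) : K) ^ 12 = ζ ^ (12 * k)
  rw [mul_comm, pow_mul]
  rcases hk with hk | hk <;> rw [hk]
  rw [Even.neg_pow (by decide)]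

theorem zpow_sum {ι G : Type*} [CommGroup G] (g : G) (s : Finset ι) (f : ι → ℤ) :
    g ^ (∑ i ∈ s, f i) = ∏ i ∈ s, g ^ f i := by
  classical
  induction s using Finset.induction_on with
  | empty => simp
  | insert i s hi ih => rw [Finset.sum_insert hi, Finset.prod_insert hi, zpow_add, ih]

theorem logMatrix_mulVec_eq_zero {v t : (𝓞 K)ˣ} {a : Fin 17 → ℤ} (ht : t ∈ Units.torsion K)
    (h : v ^ 19 = (∏ i : Fin 17, cyclotomicUnit hζ i ^ a i) * t) :
    ∃ b : Fin 18 → ZMod 19, (∀ i, b (Fin.castSucc i) = a i) ∧ logMatrix *ᵥ b = 0 := by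
  obtain ⟨k, hk⟩ := exists_pow_twelve_eq_of_mem_torsion hζ ht
  refine ⟨Fin.snoc (fun i ↦ (a i : ZMod 19)) (k : ZMod 19), fun i ↦ by simp, ?_⟩
  ext j
  have := fact_prime_229
  obtain ⟨ψ, hψ⟩ := exists_ringHom_zmod_229 hζ (coprime_embExponent j)
  have hu (i : Fin 17) : Units.map (ψ : 𝓞 K →* ZMod 229) (cyclotomicUnit hζ i) ^ 12 =
      unit218 ^ log229 (embExponent j * 40 ^ (i : ℕ) % 57) := by
    ext
    have hc : (cyclotomicUnit hζ i : 𝓞 K) = 1 - hζ.toInteger ^ 40 ^ (i : ℕ) := by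
      apply RingOfIntegers.ext
      rw [coe_cyclotomicUnit]
      rfl
    rw [Units.val_pow_eq_pow_val, Units.val_pow_eq_pow_val, Units.coe_map, MonoidHom.coe_coe, hc,
      map_sub, map_one, map_pow, hψ, ← pow_mul, pow_eq_pow_mod _ isPrimitiveRoot_151.pow_eq_one]
    exact one_sub_pow_eq_pow_log229 j i
  have htt : Units.map (ψ : 𝓞 K →* ZMod 229) t ^ 12 = unit218 ^ (embExponent j * k) := by
    ext
    rw [Units.val_pow_eq_pow_val, Units.val_pow_eq_pow_val, Units.coe_map, MonoidHom.coe_coe,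
      ← map_pow, hk, map_pow, hψ, ← pow_mul,
      show embExponent j * (12 * k) = 12 * (embExponent j * k) by ring, pow_mul]
    congr 1
  have h1 := congrArg (fun x ↦ Units.map (ψ : 𝓞 K →* ZMod 229) x ^ 12) h
  simp only [map_pow, map_mul, map_prod, map_zpow, mul_pow, ← Finset.prod_pow] at h1
  rw [← pow_mul, htt,
    ZMod.units_pow_card_sub_one_eq_one 229 (Units.map (ψ : 𝓞 K →* ZMod 229) v)] at h1
  have h2 : unit218 ^ ((∑ i : Fin 17, (log229 (embExponent j * 40 ^ (i : ℕ) % 57) : ℤ) * a i) +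
      embExponent j * k) = 1 := by
    rw [zpow_add, h1]
    refine congrArg₂ (· * ·) ?_ ?_
    · rw [zpow_sum]
      refine Finset.prod_congr rfl fun i _ ↦ ?_
      rw [zpow_mul, zpow_natCast, ← hu, ← zpow_natCast, ← zpow_natCast, zpow_comm]
    · rw [← Nat.cast_mul, zpow_natCast]
  rw [← orderOf_dvd_iff_zpow_eq_one, orderOf_unit218, ← ZMod.intCast_zmod_eq_zero_iff_dvd] at h2
  push_cast at h2
  rw [mulVec, dotProduct, Fin.sum_univ_castSucc]
  simp only [Fin.snoc_castSucc, Fin.snoc_last]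
  exact h2

theorem not_nineteen_dvd_index : ¬ 19 ∣
    (Subgroup.closure (cyclotomicUnit hζ '' Set.Iio 17) ⊔ Units.torsion K).index := by
  have := fact_prime_nineteen
  set H := Subgroup.closure (cyclotomicUnit hζ '' Set.Iio 17) ⊔ Units.torsion K with hH
  intro hdvd
  have hfin : H.FiniteIndex := ⟨fun h0 ↦ by
    have h := classNumber_eq_nine_mul_index hζ
    rw [← hH, h0, mul_zero] at h
    exact (classNumber_pos K).ne' h⟩
  have : Finite ((𝓞 K)ˣ ⧸ H) := Subgroup.finite_quotient_of_finiteIndex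
  obtain ⟨x, hx⟩ := exists_prime_orderOf_dvd_card' (G := (𝓞 K)ˣ ⧸ H) 19 hdvd
  obtain ⟨v, rfl⟩ := QuotientGroup.mk_surjective x
  have hv : v ^ 19 ∈ H := by
    rw [← QuotientGroup.eq_one_iff, QuotientGroup.mk_pow, ← hx, pow_orderOf_eq_one]
  have hvH : v ∉ H := fun h ↦ by
    rw [(QuotientGroup.eq_one_iff v).mpr h, orderOf_one] at hx
    norm_num at hx
  refine hvH ?_
  have hrange : cyclotomicUnit hζ '' Set.Iio 17 =
      Set.range fun i : Fin 17 ↦ cyclotomicUnit hζ i := by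
    ext y
    constructor
    · rintro ⟨k, hk, rfl⟩
      exact ⟨⟨k, hk⟩, rfl⟩
    · rintro ⟨i, rfl⟩
      exact ⟨i, i.2, rfl⟩
  obtain ⟨y, hy, t, ht, hyt⟩ := Subgroup.mem_sup.mp hv
  rw [hrange] at hy
  obtain ⟨a, rfl⟩ := Subgroup.mem_closure_range_iff_of_fintype.mp hy
  obtain ⟨b, hb, hA⟩ := logMatrix_mulVec_eq_zero hζ ht hyt.symm
  have hb0 : b = 0 := by
    rw [← one_mulVec b, ← logMatrixInv_mul_logMatrix, ← mulVec_mulVec, hA, mulVec_zero]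
  have ha (i : Fin 17) : (19 : ℤ) ∣ a i := by
    rw [← Nat.cast_ofNat, ← ZMod.intCast_zmod_eq_zero_iff_dvd, ← hb, hb0, Pi.zero_apply]
  choose c hc using ha
  set y := ∏ i : Fin 17, cyclotomicUnit hζ i ^ c i with hy'
  have hyH : y ∈ H := by
    refine Subgroup.mem_sup_left (Subgroup.prod_mem _ fun i _ ↦ Subgroup.zpow_mem _ ?_ _)
    exact Subgroup.subset_closure ⟨i, i.2, rfl⟩
  have hvy : (v * y⁻¹) ^ 19 = t := by
    rw [mul_pow, ← hyt, inv_pow, mul_comm, inv_mul_eq_iff_eq_mul, hy', ← Finset.prod_pow]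
    congr 1
    refine Finset.prod_congr rfl fun i _ ↦ ?_
    rw [hc, ← zpow_natCast, ← zpow_mul, mul_comm]
    rfl
  have hT : v * y⁻¹ ∈ Units.torsion K := by
    rw [Units.torsion, CommGroup.mem_torsion] at ht ⊢
    rw [← hvy] at ht
    exact ht.of_pow (by norm_num)
  rw [← inv_mul_cancel_right v y]
  exact H.mul_mem (Subgroup.mem_sup_right hT) hyH

end Index

section CyclotomicField

variable {L : Type*} [Field L] {s ζ : L}

/-- The quadratic Gauss sum of conductor `19` attached to `ζ`. -/
def quadraticGaussSum19 (ζ : L) : L :=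
  1 + 2 * (ζ + ζ ^ 4 + ζ ^ 5 + ζ ^ 6 + ζ ^ 7 + ζ ^ 9 + ζ ^ 11 + ζ ^ 16 + ζ ^ 17)

theorem quadraticGaussSum19_sq (hζ : IsPrimitiveRoot ζ 19) : quadraticGaussSum19 ζ ^ 2 = -19 := by
  have h := hζ.geom_sum_eq_zero (by norm_num)
  simp only [Finset.sum_range_succ, Finset.range_zero, Finset.sum_empty, pow_zero, pow_one,
    zero_add] at h
  rw [quadraticGaussSum19]
  linear_combination (20 - 16 * ζ - 4 * ζ ^ 3 + 4 * ζ ^ 4 + 8 * ζ ^ 5 + 8 * ζ ^ 10 - 4 * ζ ^ 13 -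
    4 * ζ ^ 14 + 4 * ζ ^ 15 + 4 * ζ ^ 16) * h

theorem quadraticGaussSum19_mem {S : Type*} [SetLike S L] [SubringClass S L] {A : S}
    (h : ζ ∈ A) : quadraticGaussSum19 ζ ∈ A := by
  have hp (n : ℕ) : ζ ^ n ∈ A := pow_mem h n
  refine add_mem (one_mem A) (mul_mem (ofNat_mem A 2) ?_)
  repeat' apply add_mem
  all_goals first | exact h | exact hp _

theorem isCyclotomicExtension_57 [CharZero L] [Algebra.IsAlgebraic ℚ L] (hs : s ^ 2 = 57)
    (hζ : IsPrimitiveRoot ζ 19) (htop : IntermediateField.adjoin ℚ ({s, ζ} : Set L) = ⊤) :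
    IsCyclotomicExtension {57} ℚ L := by
  have hg := quadraticGaussSum19_sq hζ
  set g := quadraticGaussSum19 ζ with hgdef
  set ω : L := (-1 + s * g / 19) / 2 with hω
  have hsω : s = -(2 * ω + 1) * g := by
    rw [hω]
    field_simp
    linear_combination s * hg
  have hω2 : ω ^ 2 + ω + 1 = 0 := by
    rw [hω]
    field_simp
    linear_combination s ^ 2 * hg - 19 * hs
  have hω3 : IsPrimitiveRoot ω 3 := by
    have h3 : orderOf ω = 3 := by
      have := Nat.fact_prime_three
      refine orderOf_eq_prime (by linear_combination (ω - 1) * hω2) fun h1 ↦ ?_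
      rw [h1] at hω2
      norm_num at hω2
    rw [← h3]
    exact IsPrimitiveRoot.orderOf ω
  have hprim : IsPrimitiveRoot (ω * ζ) 57 := by
    have h := (Commute.all ω ζ).orderOf_mul_eq_mul_orderOf_of_coprime (by
      rw [← hω3.eq_orderOf, ← hζ.eq_orderOf]
      norm_num)
    rw [← hω3.eq_orderOf, ← hζ.eq_orderOf] at h
    rw [show 57 = 3 * 19 from rfl, ← h]
    exact IsPrimitiveRoot.orderOf _
  rw [IsCyclotomicExtension.iff_singleton]
  refine ⟨⟨_, hprim⟩, fun x ↦ ?_⟩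
  have hζmem : ζ ∈ Algebra.adjoin ℚ {b : L | b ^ 57 = 1} := Algebra.subset_adjoin (by
    change ζ ^ (19 * 3) = 1
    rw [pow_mul, hζ.pow_eq_one, one_pow])
  have hωmem : ω ∈ Algebra.adjoin ℚ {b : L | b ^ 57 = 1} := Algebra.subset_adjoin (by
    change ω ^ (3 * 19) = 1
    rw [pow_mul, hω3.pow_eq_one, one_pow])
  have hsmem : s ∈ Algebra.adjoin ℚ {b : L | b ^ 57 = 1} := by
    rw [hsω]
    exact mul_mem (neg_mem (add_mem (mul_mem (ofNat_mem _ 2) hωmem) (one_mem _)))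
      (quadraticGaussSum19_mem hζmem)
  have h := congrArg IntermediateField.toSubalgebra htop
  rw [IntermediateField.adjoin_toSubalgebra, IntermediateField.top_toSubalgebra] at h
  have hx : x ∈ Algebra.adjoin ℚ ({s, ζ} : Set L) := h ▸ Algebra.mem_top
  refine Algebra.adjoin_le ?_ hx
  rintro y (rfl | rfl)
  · exact hsmem
  · exact hζmem

end CyclotomicField

/-- The prime `19` is `57`-regular: `19` does not divide the class number of the number field
`ℚ(√57, ζ₁₉)`, formalized here by quantifying over all number fields generated over `ℚ` by a
square root of `57` and a primitive `19`-th root of unity. -/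
theorem nineteen_is_57_regular :
    ∀ (L : Type) [Field L] [NumberField L] (s ζ : L),
      s ^ 2 = (57 : L) → IsPrimitiveRoot ζ 19 →
      IntermediateField.adjoin ℚ ({s, ζ} : Set L) = ⊤ →
      ¬ (19 ∣ NumberField.classNumber L) := by
  intro L _ _ s ζ hs hζ htop hdvd
  have := isCyclotomicExtension_57 hs hζ htop
  have hξ := IsCyclotomicExtension.zeta_spec 57 ℚ L
  rw [classNumber_eq_nine_mul_index hξ] at hdvd
  exact not_nineteen_dvd_index hξ (Nat.Coprime.dvd_of_dvd_mul_left (by norm_num) hdvd)
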